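/- Let G = G_1 ∗ ⋯ ∗ G_n be a free product of finitely generated groups. Then every injective endomorphism of G has finitely generated fixed subgroup if and only if, for each i ∈ {1,…,n}, every injective endomorphism of G_i has finitely generated fixed subgroup. -/

import Mathlib

/-- The fixed subgroup of an endomorphism. -/
def fixedSubgroup {G : Type*} [Group G] (φ : G →* G) : Subgroup G where
  carrier := {g | φ g = g}
  one_mem' := by simp
  mul_mem' := by
    intro a b ha hb
    simp only [Set.mem_setOf_eq, map_mul] at *
    rw [ha, hb]
  inv_mem' := by
    intro a ha
    simp only [Set.mem_setOf_eq, map_inv] at *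
    rw [ha]

open Monoid
open scoped InnerProductSpace InnerProduct

/-- Every injective endomorphism has finitely generated fixed subgroup. -/
def FGFPMono (A : Type*) [Group A] : Prop :=
  ∀ f : A →* A, Function.Injective f → Group.FG ↥(fixedSubgroup f)

theorem mem_fixedSubgroup {A : Type*} [Group A] {f : A →* A} {a : A} :
    a ∈ fixedSubgroup f ↔ f a = a := Iff.rfl

theorem fg_fixedSubgroup_of_semiconj {A B : Type*} [Group A] [Group B] {ψ : A →* A} {f : B →* B}
    (p : A →* B) (hp : ∀ a, p (ψ a) = f (p a)) (hs : ∀ b, f b = b → ∃ a, ψ a = a ∧ p a = b)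
    (h : Group.FG ↥(fixedSubgroup ψ)) : Group.FG ↥(fixedSubgroup f) := by
  let q : ↥(fixedSubgroup ψ) →* ↥(fixedSubgroup f) :=
    (p.comp (fixedSubgroup ψ).subtype).codRestrict (fixedSubgroup f) fun a => by
      have ha : ψ a = a := a.2
      rw [mem_fixedSubgroup]
      simp [← hp, ha]
  refine Group.fg_of_surjective (f := q) fun b => ?_
  obtain ⟨a, ha, hab⟩ := hs b b.2
  exact ⟨⟨a, ha⟩, Subtype.ext hab⟩

theorem FGFPMono.of_mulEquiv {A B : Type*} [Group A] [Group B] (e : A ≃* B) (h : FGFPMono A) :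
    FGFPMono B := by
  intro f hf
  refine fg_fixedSubgroup_of_semiconj (ψ := e.symm.toMonoidHom.comp (f.comp e.toMonoidHom))
    e.toMonoidHom (fun a => by simp) (fun b hb => ⟨e.symm b, by simp [hb], by simp⟩) (h _ ?_)
  exact e.symm.injective.comp (hf.comp e.injective)

namespace Monoid.CoprodI

theorem lift_of_comp_injective {ι : Type*} {A B : ι → Type*} [∀ i, Group (A i)]
    [∀ i, Group (B i)] (f : ∀ i, A i →* B i) (hf : ∀ i, Function.Injective (f i)) :
    Function.Injective (lift fun i => (of : B i →* CoprodI B).comp (f i)) := by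
  classical
  refine (injective_iff_map_eq_one _).mpr fun g hg => ?_
  obtain ⟨w, rfl⟩ : ∃ w : Word A, w.prod = g := ⟨Word.equiv g, Word.equiv.symm_apply_apply g⟩
  let w' : Word B :=
    ⟨w.toList.map fun p => ⟨p.1, f p.1 p.2⟩, by
      rintro l hl
      obtain ⟨p, hp, rfl⟩ := List.mem_map.mp hl
      exact fun h => w.ne_one p hp ((map_eq_one_iff _ (hf p.1)).mp h), by
      rw [List.isChain_map]
      exact w.chain_ne⟩
  have h1 : w'.prod = 1 := by
    rw [← hg, Word.prod, Word.prod, map_list_prod]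
    simp [w', Function.comp_def]
  have h2 : w' = Word.empty := Word.equiv.symm.injective (a₁ := w') (a₂ := Word.empty) (by
    change w'.prod = Word.empty.prod
    rw [h1, Word.prod_empty])
  have h3 : w.toList = [] := by simpa [w', Word.empty] using congrArg Word.toList h2
  simp [Word.prod, h3]

end Monoid.CoprodI

theorem FGFPMono.of_coprodI {ι : Type*} {L : ι → Type*} [∀ i, Group (L i)]
    (h : FGFPMono (CoprodI L)) (j : ι) : FGFPMono (L j) := by
  classical
  intro f hf
  let F : ∀ i, L i →* L i := Function.update (fun _ => MonoidHom.id _) j f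
  have hF : ∀ i, Function.Injective (F i) := fun i => by
    by_cases hi : i = j
    · subst hi; simpa [F] using hf
    · simpa [F, hi] using Function.injective_id
  let p : CoprodI L →* L j :=
    CoprodI.lift (Pi.mulSingle j (MonoidHom.id (L j)))
  have hpj : ∀ l : L j, p (CoprodI.of l) = l := fun l => by simp [p]
  refine fg_fixedSubgroup_of_semiconj (ψ := CoprodI.lift fun i => CoprodI.of.comp (F i)) p ?_
    (fun l hl => ⟨CoprodI.of l, by simp [F, hl], hpj l⟩)
    (h _ (CoprodI.lift_of_comp_injective F hF))
  refine DFunLike.congr_fun (f := p.comp (CoprodI.lift fun i => CoprodI.of.comp (F i)))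
    (g := f.comp p) (CoprodI.ext_hom _ _ fun i => ?_)
  ext l
  by_cases hi : i = j
  · subst hi; simp [hpj, F]
  · simp [p, F, hi]

section Trace

variable {X V : Type*} [NormedAddCommGroup V] [InnerProductSpace ℝ V]

theorem HilbertBasis.continuousLinearMap_ext (b : HilbertBasis X ℝ V) {W : Type*}
    [NormedAddCommGroup W] [NormedSpace ℝ W] {S T : V →L[ℝ] W} (h : ∀ x, S (b x) = T (b x)) :
    S = T :=
  ContinuousLinearMap.ext_on (Submodule.dense_iff_topologicalClosure_eq_top.mpr b.dense_span)
    (by rintro _ ⟨x, rfl⟩; exact h x)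

variable [CompleteSpace V]

/-- The unitary operator permuting a Hilbert basis by a given permutation of the index set. -/
noncomputable def HilbertBasis.permIsometry (b : HilbertBasis X ℝ V) (σ : Equiv.Perm X) :
    V ≃ₗᵢ[ℝ] V :=
  b.repr.trans (HilbertBasis.mk (b.orthonormal.comp σ σ.injective) (by
    rw [EquivLike.range_comp]; exact b.dense_span.ge)).repr.symm

theorem HilbertBasis.permIsometry_apply (b : HilbertBasis X ℝ V) (σ : Equiv.Perm X) (x : X) :
    b.permIsometry σ (b x) = b (σ x) := by
  classical
  rw [permIsometry, LinearIsometryEquiv.trans_apply, b.repr_self, HilbertBasis.repr_symm_single,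
    HilbertBasis.coe_mk]
  rfl

variable {G : Type*} [Group G]

theorem HilbertBasis.permIsometry_mulRight_inner (b : HilbertBasis G ℝ V) (g : G) (x y : V) :
    ⟪b.permIsometry (Equiv.mulRight g) x, y⟫_ℝ = ⟪x, b.permIsometry (Equiv.mulRight g⁻¹) y⟫_ℝ := by
  have h : ((b.permIsometry (Equiv.mulRight g)).toContinuousLinearEquiv : V →L[ℝ] V) ∘L
      ((b.permIsometry (Equiv.mulRight g⁻¹)).toContinuousLinearEquiv : V →L[ℝ] V) =
      ContinuousLinearMap.id ℝ V :=
    b.continuousLinearMap_ext fun x => by simp [permIsometry_apply]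
  have hy : b.permIsometry (Equiv.mulRight g) (b.permIsometry (Equiv.mulRight g⁻¹) y) = y :=
    DFunLike.congr_fun h y
  conv_lhs => rw [← hy]
  exact LinearIsometryEquiv.inner_map_map _ _ _

/-- The canonical trace is symmetric on operators commuting with right translations. -/
theorem HilbertBasis.inner_comp_comm (b : HilbertBasis G ℝ V) (S T : V →L[ℝ] V)
    (hS : ∀ g x, S (b.permIsometry (Equiv.mulRight g) x) =
      b.permIsometry (Equiv.mulRight g) (S x))
    (hT : ∀ g x, T (b.permIsometry (Equiv.mulRight g) x) =
      b.permIsometry (Equiv.mulRight g) (T x)) :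
    ⟪S (T (b 1)), b 1⟫_ℝ = ⟪T (S (b 1)), b 1⟫_ℝ := by
  have key : ∀ S T : V →L[ℝ] V, (∀ g x, S (b.permIsometry (Equiv.mulRight g) x) =
      b.permIsometry (Equiv.mulRight g) (S x)) →
      ⟪S (T (b 1)), b 1⟫_ℝ = ∑' g : G, ⟪T (b 1), b g⟫_ℝ * ⟪S (b 1), b g⁻¹⟫_ℝ := by
    intro S T hS
    rw [← ContinuousLinearMap.adjoint_inner_right, ← b.tsum_inner_mul_inner]
    refine tsum_congr fun g => ?_
    rw [ContinuousLinearMap.adjoint_inner_right]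
    have : b g = b.permIsometry (Equiv.mulRight g) (b 1) := by simp [permIsometry_apply]
    have h2 : ⟪S (b g), b 1⟫_ℝ = ⟪S (b 1), b g⁻¹⟫_ℝ := by
      rw [this, hS, permIsometry_mulRight_inner, permIsometry_apply]
      simp
    rw [h2]
  rw [key S T hS, key T S hT, ← (Equiv.inv G).tsum_eq]
  refine tsum_congr fun g => ?_
  simp [mul_comm]

end Trace

section Resolvent

variable {H : Type*} [NormedAddCommGroup H] [InnerProductSpace ℝ H] [CompleteSpace H]

theorem ContinuousLinearMap.exists_resolvent (A : H →L[ℝ] H) (hA : ∀ x, 0 ≤ ⟪A x, x⟫_ℝ)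
    {ε : ℝ} (hε : 0 < ε) :
    ∃ R : H →L[ℝ] H, (∀ x, A (R x) + ε • R x = x) ∧ ∀ x, R (A x + ε • x) = x := by
  have hu : IsUnit (A + ε • ContinuousLinearMap.id ℝ H) := by
    refine ContinuousLinearMap.isUnit_of_forall_le_norm_inner_map _ (c := ε.toNNReal) (by simpa using hε) fun x => ?_
    have : ⟪(A + ε • ContinuousLinearMap.id ℝ H) x, x⟫_ℝ = ⟪A x, x⟫_ℝ + ε * ‖x‖ ^ 2 := by
      simp [inner_add_left, real_inner_smul_left]
    rw [this, Real.norm_eq_abs]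
    refine le_trans ?_ (le_abs_self _)
    have := hA x
    rw [Real.coe_toNNReal _ hε.le]
    linarith
  obtain ⟨u, hu⟩ := hu
  refine ⟨↑u⁻¹, fun x => ?_, fun x => ?_⟩
  · have := DFunLike.congr_fun u.mul_inv x
    rw [hu] at this
    simpa using this
  · have := DFunLike.congr_fun u.inv_mul x
    rw [hu] at this
    simpa using this

omit [CompleteSpace H] in
theorem ContinuousLinearMap.norm_smul_le_of_nonneg (A : H →L[ℝ] H) (hA : ∀ x, 0 ≤ ⟪A x, x⟫_ℝ)
    (ε : ℝ) (y : H) : ε * ‖y‖ ≤ ‖A y + ε • y‖ := by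
  have h1 : ε * ‖y‖ ^ 2 ≤ ⟪A y + ε • y, y⟫_ℝ := by
    have := hA y
    simp [inner_add_left, real_inner_smul_left, this]
  have h2 := h1.trans (real_inner_le_norm _ _)
  rcases eq_or_lt_of_le (norm_nonneg y) with h | h
  · rw [← h]; simp
  · nlinarith

theorem ContinuousLinearMap.eventually_inner_resolvent_le (A : H →L[ℝ] H)
    (hA : ∀ x, 0 ≤ ⟪A x, x⟫_ℝ) (hsa : IsSelfAdjoint A) (x : H) (c : ℝ)
    (hc : ∀ z, A z = 0 → ⟪z, x⟫_ℝ = ‖z‖ ^ 2 → ⟪z, x⟫_ℝ ≤ c) {η : ℝ} (hη : 0 < η) :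
    ∃ δ > 0, ∀ ε : ℝ, 0 < ε → ε < δ → ∀ y, A y + ε • y = ε • x → ⟪y, x⟫_ℝ ≤ c + η := by
  have : CompleteSpace A.ker := A.isClosed_ker.completeSpace_coe
  obtain ⟨z, hz, x₁, hx₁, rfl⟩ := A.ker.exists_add_mem_mem_orthogonal x
  have ho : ⟪z, x₁⟫_ℝ = 0 := hx₁ z hz
  rw [ContinuousLinearMap.orthogonal_ker, hsa.adjoint_eq] at hx₁
  have hx₁' : x₁ ∈ closure (Set.range A) := hx₁
  have hzx : ⟪z, z + x₁⟫_ℝ ≤ c := by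
    refine hc z hz ?_
    rw [inner_add_right, ho, add_zero, real_inner_self_eq_norm_sq]
  set x := z + x₁ with hx
  have hpos : 0 < ‖x‖ + 1 := by positivity
  obtain ⟨_, ⟨w, rfl⟩, hw⟩ := Metric.mem_closure_iff.mp hx₁' (η / 2 / (‖x‖ + 1)) (by positivity)
  refine ⟨η / 4 / ((‖w‖ + 1) * (‖x‖ + 1)), by positivity, fun ε hε hεδ y hy => ?_⟩
  set y' := y - z - ε • w with hy'
  have h1 : A y' + ε • y' = ε • (x₁ - A w) - (ε * ε) • w := by
    have hz' : A z = 0 := hz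
    have : A y = ε • x - ε • y := by rw [← hy]; abel
    simp only [hy', map_sub, map_smul, this, hz', hx]
    module
  have h2 : ‖y'‖ ≤ ‖x₁ - A w‖ + ε * ‖w‖ := by
    have := A.norm_smul_le_of_nonneg hA ε y'
    rw [h1] at this
    have h3 := this.trans (norm_sub_le _ _)
    rw [norm_smul, norm_smul, Real.norm_of_nonneg hε.le, Real.norm_of_nonneg (by positivity)] at h3
    nlinarith
  rw [dist_eq_norm] at hw
  have h3 : y = z + ε • w + y' := by simp [hy']
  have h4 : ‖y - z‖ ≤ η / (‖x‖ + 1) := by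
    have e1 : y - z = ε • w + y' := by simp [hy']
    have e2 : ε * (‖w‖ + 1) ≤ η / 4 / (‖x‖ + 1) := by
      rw [← div_div, div_right_comm, lt_div_iff₀ (by positivity)] at hεδ
      exact hεδ.le
    have e3 : η / (‖x‖ + 1) = η / 4 / (‖x‖ + 1) + η / 4 / (‖x‖ + 1) + η / 2 / (‖x‖ + 1) := by
      ring
    rw [e1, e3]
    have := norm_add_le (ε • w) y'
    rw [norm_smul, Real.norm_of_nonneg hε.le] at this
    linarith
  have h5 : ⟪y, x⟫_ℝ = ⟪z, x⟫_ℝ + ⟪y - z, x⟫_ℝ := by rw [← inner_add_left]; simp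
  have h6 := real_inner_le_norm (y - z) x
  rw [le_div_iff₀ hpos] at h4
  have := norm_nonneg (y - z)
  nlinarith

end Resolvent

section RankBound

variable {ι : Type*} [Fintype ι] {L : ι → Type*} [∀ i, Group (L i)]
  {V : Type*} [NormedAddCommGroup V] [InnerProductSpace ℝ V] [CompleteSpace V]

/-- The linear action of a free product on `Vⁿ × V` in which the `i`-th factor acts on the last
coordinate by left translation conjugated so as to fix the `i`-th coordinate of `Vⁿ`. -/
noncomputable def affineAction (b : HilbertBasis (CoprodI L) ℝ V) :
    CoprodI L →* (PiLp 2 (fun _ : ι => V) × V →L[ℝ] PiLp 2 (fun _ : ι => V) × V) :=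
  CoprodI.lift fun i =>
    { toFun := fun l => (ContinuousLinearMap.fst ℝ _ _).prod
        (((b.permIsometry (Equiv.mulLeft (CoprodI.of l))).toContinuousLinearEquiv : V →L[ℝ] V) ∘L
          (ContinuousLinearMap.snd ℝ _ _ -
            PiLp.proj 2 (fun _ : ι => V) i ∘L ContinuousLinearMap.fst ℝ _ _) +
            PiLp.proj 2 (fun _ : ι => V) i ∘L ContinuousLinearMap.fst ℝ _ _)
      map_one' := by
        have : ((b.permIsometry (Equiv.mulLeft 1)).toContinuousLinearEquiv : V →L[ℝ] V) =
            ContinuousLinearMap.id ℝ V :=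
          b.continuousLinearMap_ext fun x => by simp [HilbertBasis.permIsometry_apply]
        rw [map_one, this]
        ext x <;> simp
      map_mul' := fun l m => by
        have : ((b.permIsometry (Equiv.mulLeft
            (CoprodI.of l * CoprodI.of m))).toContinuousLinearEquiv : V →L[ℝ] V) =
            ((b.permIsometry (Equiv.mulLeft
              (CoprodI.of l))).toContinuousLinearEquiv : V →L[ℝ] V) ∘L
            ((b.permIsometry (Equiv.mulLeft
              (CoprodI.of m))).toContinuousLinearEquiv : V →L[ℝ] V) :=
          b.continuousLinearMap_ext fun x => by
            simp [HilbertBasis.permIsometry_apply]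
        rw [map_mul, this]
        ext x <;> simp }

variable (b : HilbertBasis (CoprodI L) ℝ V)

theorem affineAction_of_apply {i : ι} (l : L i) (v : PiLp 2 (fun _ : ι => V)) (x : V) :
    affineAction b (CoprodI.of l) (v, x) =
      (v, b.permIsometry (Equiv.mulLeft (CoprodI.of l)) (x - v i) + v i) := by
  simp [affineAction, CoprodI.lift_of]

theorem affineAction_fst (g : CoprodI L) (z : PiLp 2 (fun _ : ι => V) × V) :
    (affineAction b g z).1 = z.1 := by
  induction g using CoprodI.induction_on generalizing z with
  | one => simp
  | of i l => obtain ⟨v, x⟩ := z; rw [affineAction_of_apply]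
  | mul g h hg hh => simp [hg, hh]

theorem permIsometry_mulLeft_mulRight {G : Type*} [Group G] (b : HilbertBasis G ℝ V) (g h : G)
    (x : V) :
    b.permIsometry (Equiv.mulLeft g) (b.permIsometry (Equiv.mulRight h) x) =
      b.permIsometry (Equiv.mulRight h) (b.permIsometry (Equiv.mulLeft g) x) := by
  have : ((b.permIsometry (Equiv.mulLeft g)).toContinuousLinearEquiv : V →L[ℝ] V) ∘L
      ((b.permIsometry (Equiv.mulRight h)).toContinuousLinearEquiv : V →L[ℝ] V) =
      ((b.permIsometry (Equiv.mulRight h)).toContinuousLinearEquiv : V →L[ℝ] V) ∘L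
      ((b.permIsometry (Equiv.mulLeft g)).toContinuousLinearEquiv : V →L[ℝ] V) :=
    b.continuousLinearMap_ext fun x => by simp [HilbertBasis.permIsometry_apply, mul_assoc]
  exact DFunLike.congr_fun this x

/-- Right translation on `Vⁿ`. -/
noncomputable def rightPi (h : CoprodI L) :
    PiLp 2 (fun _ : ι => V) ≃ₗᵢ[ℝ] PiLp 2 (fun _ : ι => V) :=
  LinearIsometryEquiv.piLpCongrRight 2 fun _ => b.permIsometry (Equiv.mulRight h)

theorem rightPi_apply (h : CoprodI L) (v : PiLp 2 (fun _ : ι => V)) (i : ι) :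
    rightPi b h v i = b.permIsometry (Equiv.mulRight h) (v i) := rfl

theorem affineAction_right (g h : CoprodI L) (v : PiLp 2 (fun _ : ι => V)) (x : V) :
    affineAction b g (rightPi b h v, b.permIsometry (Equiv.mulRight h) x) =
      (rightPi b h v, b.permIsometry (Equiv.mulRight h) (affineAction b g (v, x)).2) := by
  induction g using CoprodI.induction_on generalizing v x with
  | one => simp
  | of i l =>
    rw [affineAction_of_apply, affineAction_of_apply, rightPi_apply, ← map_sub,
      permIsometry_mulLeft_mulRight, ← map_add]
  | mul g k hg hk =>
    rw [map_mul, mul_apply_eq_comp, hk, hg, mul_apply_eq_comp]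
    congr
    exact (affineAction_fst b k (v, x)).symm

/-- The value at `g` of the derivation which is inner on each factor. -/
noncomputable def derivationAt (g : CoprodI L) : PiLp 2 (fun _ : ι => V) →L[ℝ] V :=
  ContinuousLinearMap.snd ℝ _ _ ∘L affineAction b g ∘L ContinuousLinearMap.inl ℝ _ _

theorem affineAction_zero (g : CoprodI L) (v : PiLp 2 (fun _ : ι => V)) :
    affineAction b g (v, 0) = (v, derivationAt b g v) :=
  Prod.ext (affineAction_fst b g _) rfl

theorem derivationAt_right (g h : CoprodI L) (v : PiLp 2 (fun _ : ι => V)) :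
    derivationAt b g (rightPi b h v) = b.permIsometry (Equiv.mulRight h) (derivationAt b g v) := by
  have := affineAction_right b g h v 0
  rw [map_zero, affineAction_zero, affineAction_zero] at this
  exact congrArg Prod.snd this

theorem derivationAt_eq_zero {S : Set (CoprodI L)} (hS : Subgroup.closure S = ⊤)
    {v : PiLp 2 (fun _ : ι => V)} (hv : ∀ s ∈ S, derivationAt b s v = 0) (g : CoprodI L) :
    derivationAt b g v = 0 := by
  have key : affineAction b g (v, 0) = (v, 0) := by
    have hg : g ∈ Subgroup.closure S := hS ▸ Subgroup.mem_top g
    induction hg using Subgroup.closure_induction with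
    | mem s hs => rw [affineAction_zero, hv s hs]
    | one => simp
    | mul x y _ _ hx hy => rw [map_mul, mul_apply_eq_comp, hy, hx]
    | inv x _ hx =>
      conv_lhs => rw [← hx]
      rw [← mul_apply_eq_comp, ← map_mul, inv_mul_cancel, map_one]
      rfl
  rw [affineAction_zero] at key
  exact congrArg Prod.snd key

theorem permIsometry_of_derivationAt_eq_zero {v : PiLp 2 (fun _ : ι => V)}
    (hv : ∀ g, derivationAt b g v = 0) {i : ι} (l : L i) :
    b.permIsometry (Equiv.mulLeft (CoprodI.of l)) (v i) = v i := by
  have := affineAction_zero b (CoprodI.of l) v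
  rw [hv, affineAction_of_apply, zero_sub, map_neg] at this
  have := congrArg Prod.snd this
  exact (neg_add_eq_zero.mp this)

theorem LinearIsometryEquiv.adjoint_comm {H : Type*} [NormedAddCommGroup H]
    [InnerProductSpace ℝ H] [CompleteSpace H] {D : H →L[ℝ] V} {U : H ≃ₗᵢ[ℝ] H} {W : V ≃ₗᵢ[ℝ] V}
    (h : ∀ x, D (U x) = W (D x)) (y : V) :
    ContinuousLinearMap.adjoint D (W y) = U (ContinuousLinearMap.adjoint D y) := by
  refine ext_inner_right ℝ fun x => ?_
  obtain ⟨x, rfl⟩ := U.surjective x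
  rw [ContinuousLinearMap.adjoint_inner_left, h, LinearIsometryEquiv.inner_map_map,
    LinearIsometryEquiv.inner_map_map, ContinuousLinearMap.adjoint_inner_left]

/-- The `i`-th coordinate inclusion of `V` into `Vⁿ`. -/
noncomputable def singleL [DecidableEq ι] (i : ι) : V →L[ℝ] PiLp 2 (fun _ : ι => V) :=
  ((PiLp.continuousLinearEquiv 2 ℝ (fun _ : ι => V)).symm :
    (ι → V) →L[ℝ] PiLp 2 (fun _ : ι => V)) ∘L ContinuousLinearMap.single ℝ (fun _ => V) i

omit [CompleteSpace V] in
theorem inner_singleL [DecidableEq ι] (i : ι) (v : PiLp 2 (fun _ : ι => V)) (x : V) :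
    ⟪v, singleL i x⟫_ℝ = ⟪v i, x⟫_ℝ := by
  rw [PiLp.inner_apply, Finset.sum_eq_single i]
  · simp [singleL]
  · intro j _ hj; simp [singleL, hj]
  · simp

omit [CompleteSpace V] in
theorem sum_singleL [DecidableEq ι] (v : PiLp 2 (fun _ : ι => V)) :
    ∑ i, singleL i (v i) = v := by
  ext j
  simp [singleL, Pi.single_apply]

theorem singleL_right [DecidableEq ι] (i : ι) (h : CoprodI L) (x : V) :
    singleL i (b.permIsometry (Equiv.mulRight h) x) = rightPi b h (singleL i x) := by
  ext j
  rw [rightPi_apply]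
  by_cases hj : j = i
  · subst hj; simp [singleL]
  · simp [singleL, hj]

end RankBound

section RankBoundSum

variable {ι : Type*} [Fintype ι] {L : ι → Type*} [∀ i, Group (L i)]
  {V : Type*} [NormedAddCommGroup V] [InnerProductSpace ℝ V] [CompleteSpace V]

theorem sum_adjoint_inner {H κ : Type*} [NormedAddCommGroup H] [InnerProductSpace ℝ H]
    [CompleteSpace H] (S : Finset κ) (D : κ → H →L[ℝ] V) (x y : H) :
    ⟪(∑ s ∈ S, ContinuousLinearMap.adjoint (D s) ∘L D s) x, y⟫_ℝ =
      ∑ s ∈ S, ⟪D s x, D s y⟫_ℝ := by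
  simp [sum_inner, ContinuousLinearMap.adjoint_inner_left]

theorem norm_comp_resolvent_le {H κ : Type*} [NormedAddCommGroup H] [InnerProductSpace ℝ H]
    [CompleteSpace H] (S : Finset κ) (D : κ → H →L[ℝ] V) {ε : ℝ} (hε : 0 ≤ ε) {s : κ} (hs : s ∈ S)
    {x : H} {y : V} (hx : (∑ s ∈ S, ContinuousLinearMap.adjoint (D s) ∘L D s) x + ε • x =
      ContinuousLinearMap.adjoint (D s) y) : ‖D s x‖ ≤ ‖y‖ := by
  have h1 : ⟪(∑ s ∈ S, ContinuousLinearMap.adjoint (D s) ∘L D s) x + ε • x, x⟫_ℝ =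
      ⟪y, D s x⟫_ℝ := by rw [hx, ContinuousLinearMap.adjoint_inner_left]
  rw [inner_add_left, sum_adjoint_inner, real_inner_smul_left, real_inner_self_eq_norm_sq] at h1
  have h2 : ⟪D s x, D s x⟫_ℝ ≤ ∑ s ∈ S, ⟪D s x, D s x⟫_ℝ :=
    Finset.single_le_sum (f := fun s => ⟪D s x, D s x⟫_ℝ)
      (fun s _ => real_inner_self_nonneg) hs
  rw [real_inner_self_eq_norm_sq] at h2
  have h3 := real_inner_le_norm y (D s x)
  have h4 : 0 ≤ ε * ‖x‖ ^ 2 := by positivity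
  rcases (norm_nonneg (D s x)).eq_or_lt with h | h
  · rw [← h]; exact norm_nonneg y
  · nlinarith

variable (b : HilbertBasis (CoprodI L) ℝ V)

theorem sum_inner_resolvent_le [DecidableEq ι] (S : Finset (CoprodI L)) {ε : ℝ} (hε : 0 < ε)
    (R : PiLp 2 (fun _ : ι => V) →L[ℝ] PiLp 2 (fun _ : ι => V))
    (hR : ∀ x, (∑ s ∈ S, ContinuousLinearMap.adjoint (derivationAt b s) ∘L derivationAt b s) (R x)
      + ε • R x = x)
    (hR' : ∀ x, R ((∑ s ∈ S, ContinuousLinearMap.adjoint (derivationAt b s) ∘L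
      derivationAt b s) x + ε • x) = x) :
    ∑ i, (1 - ε * ⟪R (singleL i (b 1)), singleL i (b 1)⟫_ℝ) ≤ S.card := by
  set A := ∑ s ∈ S, ContinuousLinearMap.adjoint (derivationAt b s) ∘L derivationAt b s with hA
  have hn : ⟪b 1, b 1⟫_ℝ = 1 := by rw [real_inner_self_eq_norm_sq, b.orthonormal.1 1, one_pow]
  have hadj : ∀ s g y, ContinuousLinearMap.adjoint (derivationAt b s)
      (b.permIsometry (Equiv.mulRight g) y) =
      rightPi b g (ContinuousLinearMap.adjoint (derivationAt b s) y) := fun s g y =>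
    LinearIsometryEquiv.adjoint_comm (derivationAt_right b s g) y
  have hAr : ∀ g x, A (rightPi b g x) = rightPi b g (A x) := by
    intro g x
    simp only [hA, sum_apply, ContinuousLinearMap.comp_apply, map_sum,
      derivationAt_right, hadj]
  have hRr : ∀ g x, R (rightPi b g x) = rightPi b g (R x) := by
    intro g x
    conv_lhs => rw [← hR x, map_add, map_smul, ← hAr, hR']
  have h1 : ∀ i, 1 - ε * ⟪R (singleL i (b 1)), singleL i (b 1)⟫_ℝ =
      ⟪R (A (singleL i (b 1))), singleL i (b 1)⟫_ℝ := by
    intro i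
    have h2 : ⟪R (A (singleL i (b 1)) + ε • singleL i (b 1)), singleL i (b 1)⟫_ℝ = 1 := by
      rw [hR', inner_singleL]
      simpa [singleL] using hn
    rw [map_add, map_smul, inner_add_left, real_inner_smul_left] at h2
    linarith
  have h2 : ∀ s i, ⟪R (ContinuousLinearMap.adjoint (derivationAt b s)
      (derivationAt b s (singleL i (b 1)))), singleL i (b 1)⟫_ℝ =
      ⟪derivationAt b s (singleL i (R (ContinuousLinearMap.adjoint (derivationAt b s) (b 1)) i)),
        b 1⟫_ℝ := by
    intro s i
    rw [inner_singleL]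
    refine b.inner_comp_comm (PiLp.proj 2 (fun _ : ι => V) i ∘L R ∘L
      ContinuousLinearMap.adjoint (derivationAt b s))
      (derivationAt b s ∘L singleL i) (fun g x => ?_) (fun g x => ?_)
    · simp only [ContinuousLinearMap.comp_apply, hadj, hRr]
      rfl
    · simp only [ContinuousLinearMap.comp_apply, singleL_right, derivationAt_right]
  calc _ = ∑ i, ∑ s ∈ S, ⟪R (ContinuousLinearMap.adjoint (derivationAt b s)
      (derivationAt b s (singleL i (b 1)))), singleL i (b 1)⟫_ℝ := by
        refine Finset.sum_congr rfl fun i _ => ?_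
        rw [h1, hA, sum_apply, map_sum, sum_inner]
        rfl
    _ = ∑ s ∈ S, ⟪derivationAt b s (R (ContinuousLinearMap.adjoint (derivationAt b s) (b 1))),
        b 1⟫_ℝ := by
        rw [Finset.sum_comm]
        refine Finset.sum_congr rfl fun s _ => ?_
        simp_rw [h2]
        rw [← sum_inner, ← map_sum, sum_singleL]
    _ ≤ ∑ s ∈ S, 1 := by
        refine Finset.sum_le_sum fun s hs => ?_
        have h3 := norm_comp_resolvent_le S (derivationAt b) hε.le hs
          (hR (ContinuousLinearMap.adjoint (derivationAt b s) (b 1)))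
        have h4 := real_inner_le_norm
          (derivationAt b s (R (ContinuousLinearMap.adjoint (derivationAt b s) (b 1)))) (b 1)
        rw [b.orthonormal.1 1] at h3 h4
        linarith
    _ = S.card := by simp

theorem inner_le_half_of_derivationAt_eq_zero [DecidableEq ι] {v : PiLp 2 (fun _ : ι => V)}
    (hv : ∀ g, derivationAt b g v = 0) {i : ι} [Nontrivial (L i)]
    (h : ⟪v, singleL i (b 1)⟫_ℝ = ‖v‖ ^ 2) : ⟪v, singleL i (b 1)⟫_ℝ ≤ 1 / 2 := by
  obtain ⟨l, hl⟩ := exists_ne (1 : L i)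
  have h1 : ⟪v i, b (CoprodI.of l)⟫_ℝ = ⟪v i, b 1⟫_ℝ := by
    conv_lhs => rw [← permIsometry_of_derivationAt_eq_zero b hv l]
    rw [← LinearIsometryEquiv.inner_map_map (b.permIsometry (Equiv.mulLeft (CoprodI.of l)))
      (v i) (b 1), b.permIsometry_apply]
    simp
  have hne : (CoprodI.of l : CoprodI L) ≠ 1 := by
    rwa [Ne, map_eq_one_iff _ (CoprodI.of_injective i)]
  have h2 : ‖b (CoprodI.of l) + b 1‖ ^ 2 = 2 := by
    rw [norm_add_sq_real, b.orthonormal.1, b.orthonormal.1, b.orthonormal.2 hne]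
    norm_num
  have h3 : 2 * ⟪v, singleL i (b 1)⟫_ℝ = ⟪v i, b (CoprodI.of l) + b 1⟫_ℝ := by
    rw [inner_add_right, h1, inner_singleL]; ring
  have h4 := real_inner_le_norm (v i) (b (CoprodI.of l) + b 1)
  have h5 := PiLp.norm_apply_le v i
  have h6 := norm_nonneg (b (CoprodI.of l) + b 1)
  have h7 := norm_nonneg (v i)
  have h8 : 2 * ⟪v, singleL i (b 1)⟫_ℝ ≤ ‖v‖ * ‖b (CoprodI.of l) + b 1‖ := by
    rw [h3]; exact h4.trans (mul_le_mul_of_nonneg_right h5 h6)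
  nlinarith [sq_nonneg (2 * ‖v‖ - ‖b (CoprodI.of l) + b 1‖)]

theorem card_nontrivial_le_of_hilbertBasis (b : HilbertBasis (CoprodI L) ℝ V) (S : Finset (CoprodI L))
    (hS : Subgroup.closure (S : Set (CoprodI L)) = ⊤) (T : Finset ι)
    (hT : ∀ i ∈ T, Nontrivial (L i)) : T.card ≤ 2 * S.card := by
  classical
  set A := ∑ s ∈ S, ContinuousLinearMap.adjoint (derivationAt b s) ∘L derivationAt b s with hA
  have hpos : ∀ x, 0 ≤ ⟪A x, x⟫_ℝ := fun x => by
    rw [hA, sum_adjoint_inner]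
    exact Finset.sum_nonneg fun s _ => real_inner_self_nonneg
  have hsa : IsSelfAdjoint A := by
    rw [ContinuousLinearMap.isSelfAdjoint_iff_isSymmetric]
    intro x y
    change ⟪A x, y⟫_ℝ = ⟪x, A y⟫_ℝ
    rw [real_inner_comm (A y) x, hA, sum_adjoint_inner, sum_adjoint_inner]
    exact Finset.sum_congr rfl fun s _ => real_inner_comm _ _
  have hker : ∀ z, A z = 0 → ∀ g, derivationAt b g z = 0 := by
    intro z hz
    refine derivationAt_eq_zero b hS fun s hs => ?_
    have : ∑ s ∈ S, ⟪derivationAt b s z, derivationAt b s z⟫_ℝ = 0 := by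
      rw [← sum_adjoint_inner, ← hA, hz, inner_zero_left]
    rw [Finset.sum_eq_zero_iff_of_nonneg fun s _ => real_inner_self_nonneg] at this
    exact inner_self_eq_zero.mp (this s hs)
  have hη : (0 : ℝ) < 1 / (4 * (T.card + 1)) := by positivity
  have hδ : ∀ i : ι, ∃ δ > 0, ∀ ε : ℝ, 0 < ε → ε < δ → i ∈ T → ∀ y,
      A y + ε • y = ε • singleL i (b 1) → ⟪y, singleL i (b 1)⟫_ℝ ≤ 1 / 2 + 1 / (4 * (T.card + 1)) := by
    intro i
    by_cases hi : i ∈ T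
    · have := hT i hi
      obtain ⟨δ, h0, h⟩ := A.eventually_inner_resolvent_le hpos hsa (singleL i (b 1)) (1 / 2)
        (fun z hz h => inner_le_half_of_derivationAt_eq_zero b (hker z hz) h) hη
      exact ⟨δ, h0, fun ε h1 h2 _ => h ε h1 h2⟩
    · exact ⟨1, one_pos, fun _ _ _ h => absurd h hi⟩
  choose δ hδ0 hδ using hδ
  obtain ⟨ε, hεδ, hε⟩ : ∃ ε : ℝ, (∀ i, ε < δ i) ∧ 0 < ε := by
    have h1 : ∀ᶠ ε : ℝ in nhdsWithin 0 (Set.Ioi 0), ∀ i, ε < δ i :=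
      Filter.eventually_all.mpr fun i =>
        nhdsWithin_le_nhds (Iio_mem_nhds (hδ0 i))
    exact (h1.and self_mem_nhdsWithin).exists
  obtain ⟨R, hR, hR'⟩ := A.exists_resolvent hpos hε
  have key := sum_inner_resolvent_le b S hε R hR hR'
  have hn : ⟪b 1, b 1⟫_ℝ = 1 := by rw [real_inner_self_eq_norm_sq, b.orthonormal.1 1, one_pow]
  have hn' : ∀ i : ι, ‖(singleL i (b 1) : PiLp 2 (fun _ : ι => V))‖ = 1 := fun i => by
    rw [← sq_eq_sq₀ (norm_nonneg _) zero_le_one, ← real_inner_self_eq_norm_sq, inner_singleL]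
    simpa [singleL] using hn
  have hsolve : ∀ i, A (ε • R (singleL i (b 1))) + ε • ε • R (singleL i (b 1)) =
      ε • singleL i (b 1) := fun i => by rw [map_smul, ← smul_add, hR]
  have hle : ∀ i, 0 ≤ 1 - ε * ⟪R (singleL i (b 1)), singleL i (b 1)⟫_ℝ := by
    intro i
    have h1 := A.norm_smul_le_of_nonneg hpos ε (R (singleL i (b 1)))
    rw [hR, hn'] at h1
    have h2 := real_inner_le_norm (R (singleL i (b 1))) (singleL i (b 1))
    rw [hn', mul_one] at h2
    nlinarith
  have h3 : ∑ i ∈ T, (1 / 2 - 1 / (4 * ((T.card : ℝ) + 1))) ≤ S.card := by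
    refine le_trans (le_trans (Finset.sum_le_sum fun i hi => ?_)
      (Finset.sum_le_sum_of_subset_of_nonneg (Finset.subset_univ T) fun i _ _ => hle i)) key
    have := hδ i ε hε (hεδ i) hi _ (hsolve i)
    rw [real_inner_smul_left] at this
    linarith
  rw [Finset.sum_const, nsmul_eq_mul, mul_sub] at h3
  have h4 : (T.card : ℝ) * (1 / (4 * ((T.card : ℝ) + 1))) < 1 / 2 := by
    rw [mul_one_div, div_lt_iff₀ (by positivity)]
    have : (0 : ℝ) ≤ T.card := by positivity
    linarith
  have h5 : (T.card : ℝ) < 2 * S.card + 1 := by linarith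
  exact Nat.lt_succ_iff.mp (by exact_mod_cast h5)

end RankBoundSum

/-- A free product generated by `r` elements has at most `2 * r` nontrivial factors. -/
theorem Monoid.CoprodI.card_nontrivial_le {ι : Type*} [Fintype ι] {L : ι → Type*}
    [∀ i, Group (L i)] (S : Finset (CoprodI L))
    (hS : Subgroup.closure (S : Set (CoprodI L)) = ⊤) (T : Finset ι)
    (hT : ∀ i ∈ T, Nontrivial (L i)) : T.card ≤ 2 * S.card :=
  card_nontrivial_le_of_hilbertBasis
    (HilbertBasis.ofRepr (LinearIsometryEquiv.refl ℝ (lp (fun _ : CoprodI L => ℝ) 2))) S hS T hT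

section Flow

variable {Γ X : Type*} [Group Γ] [MulAction Γ X] {p : X → X}

/-- Two points are flow equivalent if their forward orbits under `p` meet. -/
def FlowEquiv (p : X → X) (x y : X) : Prop := ∃ m n : ℕ, p^[m] x = p^[n] y

theorem FlowEquiv.refl (x : X) : FlowEquiv p x x := ⟨0, 0, rfl⟩

theorem FlowEquiv.symm {x y : X} : FlowEquiv p x y → FlowEquiv p y x :=
  fun ⟨m, n, h⟩ => ⟨n, m, h.symm⟩

theorem FlowEquiv.trans {x y z : X} : FlowEquiv p x y → FlowEquiv p y z → FlowEquiv p x z := by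
  rintro ⟨m, n, h⟩ ⟨k, l, h'⟩
  refine ⟨k + m, n + l, ?_⟩
  rw [Function.iterate_add_apply, h, Function.iterate_add_apply, ← h',
    ← Function.iterate_add_apply, ← Function.iterate_add_apply, add_comm]

theorem FlowEquiv.of_apply (x : X) : FlowEquiv p x (p x) := ⟨1, 0, rfl⟩

theorem iterate_smul (hp : ∀ (γ : Γ) x, p (γ • x) = γ • p x) (γ : Γ) (n : ℕ) (x : X) :
    p^[n] (γ • x) = γ • p^[n] x :=
  ((show Function.Semiconj (γ • ·) p p from fun x => (hp γ x).symm).iterate_right n x).symm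

theorem FlowEquiv.smul (hp : ∀ (γ : Γ) x, p (γ • x) = γ • p x) (γ : Γ) {x y : X} :
    FlowEquiv p x y → FlowEquiv p (γ • x) (γ • y) :=
  fun ⟨m, n, h⟩ => ⟨m, n, by rw [iterate_smul hp, iterate_smul hp, h]⟩

/-- The stabilizer of a flow equivalence class. -/
def flowStabilizer (hp : ∀ (γ : Γ) x, p (γ • x) = γ • p x) (x : X) : Subgroup Γ where
  carrier := {γ | FlowEquiv p (γ • x) x}
  one_mem' := by simpa using FlowEquiv.refl x
  mul_mem' := fun {a b} ha hb => by
    have := (FlowEquiv.smul hp a hb).trans ha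
    rwa [smul_smul] at this
  inv_mem' := fun {a} ha => by
    have := FlowEquiv.smul hp a⁻¹ ha
    rw [inv_smul_smul] at this
    exact this.symm

theorem mem_flowStabilizer {hp : ∀ (γ : Γ) x, p (γ • x) = γ • p x} {x : X} {γ : Γ} :
    γ ∈ flowStabilizer hp x ↔ FlowEquiv p (γ • x) x := Iff.rfl

theorem flowStabilizer_congr {hp : ∀ (γ : Γ) x, p (γ • x) = γ • p x} {x y : X}
    (h : FlowEquiv p x y) : flowStabilizer hp x = flowStabilizer hp y := by
  ext γ
  exact ⟨fun hγ => ((FlowEquiv.smul hp γ h).symm.trans hγ).trans h,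
    fun hγ => ((FlowEquiv.smul hp γ h).trans hγ).trans h.symm⟩

theorem flowStabilizer_of_fixed {hp : ∀ (γ : Γ) x, p (γ • x) = γ • p x} {x : X} (h : p x = x) :
    flowStabilizer hp x = MulAction.stabilizer Γ x := by
  ext γ
  rw [mem_flowStabilizer, MulAction.mem_stabilizer_iff]
  refine ⟨fun ⟨m, n, hmn⟩ => ?_, fun hγ => by rw [hγ]; exact FlowEquiv.refl _⟩
  rwa [iterate_smul hp, Function.iterate_fixed h, Function.iterate_fixed h] at hmn

theorem flowStabilizer_fg (hp : ∀ (γ : Γ) x, p (γ • x) = γ • p x)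
    (hstab : ∀ x : X, (MulAction.stabilizer Γ x).FG)
    (htriv : ∀ x : X, p x ≠ x → MulAction.stabilizer Γ x = ⊥) (x : X) :
    (flowStabilizer hp x).FG := by
  by_cases hx : ∃ y, FlowEquiv p x y ∧ p y = y
  · obtain ⟨y, hxy, hy⟩ := hx
    rw [flowStabilizer_congr hxy, flowStabilizer_of_fixed hy]
    exact hstab y
  push Not at hx
  let D : Γ → ℤ → Prop := fun γ k => ∃ m n : ℕ, γ • p^[m] x = p^[n] x ∧ (n : ℤ) - m = k
  have hD0 : ∀ γ, D γ 0 → γ = 1 := by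
    rintro γ ⟨m, n, h, hmn⟩
    obtain rfl : n = m := by omega
    have : γ ∈ MulAction.stabilizer Γ (p^[n] x) := h
    rwa [htriv _ (hx _ ⟨n, 0, rfl⟩), Subgroup.mem_bot] at this
  have hDmul : ∀ γ δ k l, D γ k → D δ l → D (γ * δ) (k + l) := by
    rintro γ δ _ _ ⟨m, n, h, rfl⟩ ⟨m', n', h', rfl⟩
    refine ⟨m + m', n' + n, ?_, by push_cast; ring⟩
    rw [mul_smul, Function.iterate_add_apply, ← iterate_smul hp δ m, h', ← Function.iterate_add_apply,
      add_comm m n', Function.iterate_add_apply, ← iterate_smul hp, h, ← Function.iterate_add_apply]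
  have hDinv : ∀ γ k, D γ k → D γ⁻¹ (-k) := by
    rintro γ _ ⟨m, n, h, rfl⟩
    exact ⟨n, m, by rw [← h, inv_smul_smul], by ring⟩
  have hD1 : D 1 0 := ⟨0, 0, by simp, by simp⟩
  let K : AddSubgroup ℤ :=
    { carrier := {k | ∃ γ, D γ k}
      zero_mem' := ⟨1, hD1⟩
      add_mem' := fun ⟨γ, h⟩ ⟨δ, h'⟩ => ⟨γ * δ, hDmul _ _ _ _ h h'⟩
      neg_mem' := fun ⟨γ, h⟩ => ⟨γ⁻¹, hDinv _ _ h⟩ }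
  obtain ⟨d, hd⟩ := Int.subgroup_cyclic K
  obtain ⟨γ₀, hγ₀⟩ : d ∈ K := by rw [hd]; exact AddSubgroup.subset_closure rfl
  have hpow : ∀ c : ℤ, D (γ₀ ^ c) (c * d) := by
    intro c
    induction c using Int.induction_on with
    | zero => simpa using hD1
    | succ i hi =>
      have := hDmul _ _ _ _ hi hγ₀
      rwa [← zpow_add_one, show (i : ℤ) * d + d = (i + 1) * d by ring] at this
    | pred i hi =>
      have := hDmul _ _ _ _ hi (hDinv _ _ hγ₀)
      rwa [← zpow_sub_one, show -(i : ℤ) * d + -d = (-i - 1) * d by ring] at this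
  have hmem : ∀ γ, γ ∈ flowStabilizer hp x ↔ ∃ k, D γ k := fun γ =>
    ⟨fun ⟨m, n, h⟩ => ⟨_, m, n, by rwa [iterate_smul hp] at h, rfl⟩,
      fun ⟨_, m, n, h, _⟩ => ⟨m, n, by rwa [iterate_smul hp]⟩⟩
  refine ⟨{γ₀}, le_antisymm ?_ ?_⟩
  · rw [Subgroup.closure_le]
    simpa using (hmem γ₀).mpr ⟨d, hγ₀⟩
  · intro γ hγ
    obtain ⟨k, hk⟩ := (hmem γ).mp hγ
    have hkK : k ∈ K := ⟨γ, hk⟩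
    rw [hd, AddSubgroup.mem_closure_singleton] at hkK
    obtain ⟨c, rfl⟩ := hkK
    rw [Finset.coe_singleton, Subgroup.mem_closure_singleton]
    refine ⟨c, ?_⟩
    have := hDmul _ _ _ _ hk (hDinv _ _ (hpow c))
    rw [smul_eq_mul, add_neg_cancel] at this
    exact (mul_inv_eq_one.mp (hD0 _ this)).symm

theorem group_fg_of_flow (hp : ∀ (γ : Γ) x, p (γ • x) = γ • p x)
    (hstab : ∀ x : X, (MulAction.stabilizer Γ x).FG)
    (htriv : ∀ x : X, p x ≠ x → MulAction.stabilizer Γ x = ⊥) {B : Set (X × X)} (hB : B.Finite)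
    (x₀ : X)
    (hconn : ∀ γ : Γ, Relation.EqvGen
      (fun x y => y = p x ∨ ∃ δ : Γ, ∃ e ∈ B, x = δ • e.1 ∧ y = δ • e.2) x₀ (γ • x₀)) :
    Group.FG Γ := by
  classical
  let Z : Set X := insert x₀ (Prod.fst '' B ∪ Prod.snd '' B)
  have hZ : Z.Finite := ((hB.image _).union (hB.image _)).insert _
  let g : X → X → Γ := fun z z' => if h : ∃ γ : Γ, FlowEquiv p (γ • z) z' then h.choose else 1
  have hg : ∀ z z', (∃ γ : Γ, FlowEquiv p (γ • z) z') → FlowEquiv p (g z z' • z) z' := by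
    intro z z' h
    simp only [g, dif_pos h]
    exact h.choose_spec
  have hfg : ∀ z, ∃ S : Finset Γ, Subgroup.closure (S : Set Γ) = flowStabilizer hp z :=
    fun z => flowStabilizer_fg hp hstab htriv z
  choose S hS using hfg
  let T : Set Γ := (⋃ z ∈ Z, (S z : Set Γ)) ∪ Set.image2 g Z Z
  have hT : T.Finite := (hZ.biUnion fun z _ => (S z).finite_toSet).union (hZ.image2 _ hZ)
  set Γ' := Subgroup.closure T with hΓ'
  have hstabΓ' : ∀ z ∈ Z, flowStabilizer hp z ≤ Γ' := by
    intro z hz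
    rw [← hS]
    exact Subgroup.closure_mono fun s hs => Or.inl (Set.mem_biUnion hz hs)
  have key : ∀ a ∈ Z, ∀ z ∈ Z, ∀ γ' ∈ Γ', ∀ γ, FlowEquiv p (γ • a) (γ' • z) → γ ∈ Γ' := by
    intro a ha z hz γ' hγ' γ h
    have h1 : FlowEquiv p ((γ'⁻¹ * γ) • a) z := by
      have := h.smul hp γ'⁻¹
      rwa [inv_smul_smul, smul_smul] at this
    have h2 := hg a z ⟨_, h1⟩
    have h3 : (g a z)⁻¹ * (γ'⁻¹ * γ) ∈ Γ' := by
      refine hstabΓ' a ha ?_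
      have := (h1.trans h2.symm).smul hp (g a z)⁻¹
      rwa [inv_smul_smul, smul_smul] at this
    have h4 : g a z ∈ Γ' := Subgroup.subset_closure (Or.inr ⟨a, ha, z, hz, rfl⟩)
    have h5 := mul_mem hγ' (mul_mem h4 h3)
    simpa using h5
  let P : X → Prop := fun x => ∃ z ∈ Z, ∃ γ ∈ Γ', FlowEquiv p x (γ • z)
  have hP : ∀ x y, Relation.EqvGen
      (fun x y => y = p x ∨ ∃ δ : Γ, ∃ e ∈ B, x = δ • e.1 ∧ y = δ • e.2) x y → (P x ↔ P y) := by
    intro x y h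
    induction h with
    | rel x y h =>
      rcases h with rfl | ⟨δ, e, he, rfl, rfl⟩
      · exact ⟨fun ⟨z, hz, γ, hγ, h⟩ => ⟨z, hz, γ, hγ, (FlowEquiv.of_apply x).symm.trans h⟩,
          fun ⟨z, hz, γ, hγ, h⟩ => ⟨z, hz, γ, hγ, (FlowEquiv.of_apply x).trans h⟩⟩
      · have h1 : e.1 ∈ Z := Or.inr (Or.inl ⟨e, he, rfl⟩)
        have h2 : e.2 ∈ Z := Or.inr (Or.inr ⟨e, he, rfl⟩)
        exact ⟨fun ⟨z, hz, γ, hγ, h⟩ => ⟨_, h2, δ, key _ h1 z hz γ hγ δ h, FlowEquiv.refl _⟩,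
          fun ⟨z, hz, γ, hγ, h⟩ => ⟨_, h1, δ, key _ h2 z hz γ hγ δ h, FlowEquiv.refl _⟩⟩
    | refl x => rfl
    | symm x y _ ih => exact ih.symm
    | trans x y z _ _ ih ih' => exact ih.trans ih'
  have hx₀ : x₀ ∈ Z := Set.mem_insert _ _
  have hP₀ : P x₀ := ⟨x₀, hx₀, 1, one_mem _, by rw [one_smul]; exact FlowEquiv.refl _⟩
  refine Group.fg_iff.mpr ⟨T, ?_, hT⟩
  refine eq_top_iff.mpr fun γ _ => ?_
  obtain ⟨z, hz, γ', hγ', h⟩ := (hP _ _ (hconn γ)).mp hP₀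
  exact key x₀ hx₀ z hz γ' hγ' γ h

end Flow

namespace Monoid.CoprodI

variable {ι : Type*} {M : ι → Type*} [∀ i, Group (M i)]

open Classical in
/-- The leading letter of the reduced word of `g` if it lies in the `i`-th factor, and `1`
otherwise. -/
noncomputable def lead (i : ι) (g : CoprodI M) : M i :=
  (Word.equivPair i (g • (Word.empty : Word M))).head

@[simp]
theorem lead_of_mul (i : ι) (m : M i) (g : CoprodI M) : lead i (of m * g) = m * lead i g := by
  classical
  rw [lead, mul_smul]
  exact congrArg Word.Pair.head (Word.equivPair_smul_same m (g • (Word.empty : Word M)))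

@[simp]
theorem lead_one (i : ι) : lead i (1 : CoprodI M) = 1 := by
  classical
  rw [lead, one_smul, Word.equivPair_eq_of_fstIdx_ne]
  simp [Word.fstIdx, Word.empty]

@[simp]
theorem lead_of (i : ι) (m : M i) : lead i (of m : CoprodI M) = m := by
  simpa using lead_of_mul i m (1 : CoprodI M)

theorem eq_of_lead_ne_one {i j : ι} {g : CoprodI M} (hi : lead i g ≠ 1) (hj : lead j g ≠ 1) :
    i = j := by
  classical
  have h : ∀ k, lead k g ≠ 1 → (g • (Word.empty : Word M)).fstIdx = some k := by
    intro k hk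
    by_contra h
    exact hk (by rw [lead, Word.equivPair_eq_of_fstIdx_ne h])
  exact Option.some_injective _ ((h i hi).symm.trans (h j hj))

theorem lead_eq_one_of_ne {i j : ι} (hij : i ≠ j) {g : CoprodI M} (hi : lead i g ≠ 1) :
    lead j g = 1 :=
  by_contra fun hj => hij (eq_of_lead_ne_one hi hj)

theorem lead_induction {P : CoprodI M → Prop} (one : P 1)
    (cons : ∀ (i : ι) (m : M i) (g : CoprodI M), m ≠ 1 → lead i g = 1 → P g → P (of m * g))
    (g : CoprodI M) : P g := by
  classical
  obtain ⟨w, rfl⟩ : ∃ w : Word M, w.prod = g := ⟨Word.equiv g, Word.equiv.symm_apply_apply g⟩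
  induction w using Word.consRecOn with
  | empty => exact one
  | cons i m w h1 h2 ih =>
    rw [Word.prod_cons]
    refine cons i m _ h2 ?_ ih
    have : w.prod • (Word.empty : Word M) = w := Word.equiv.apply_symm_apply w
    rw [lead, this, Word.equivPair_eq_of_fstIdx_ne h1]

theorem lead_mul_of (j k : ι) (g : CoprodI M) (h : M k)
    (hg : j = k → g ∉ (of : M j →* CoprodI M).range) :
    lead j (g * of h) = lead j g := by
  induction g using lead_induction generalizing j with
  | one =>
    have hjk : k ≠ j := fun e => hg e.symm (one_mem _)
    rw [one_mul, lead_one]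
    by_cases hh : h = 1
    · simp [hh]
    · exact lead_eq_one_of_ne hjk (by simpa using hh)
  | cons i m g hm hlead ih =>
    rw [mul_assoc]
    by_cases hj : j = i
    · subst hj
      rw [lead_of_mul, lead_of_mul, ih]
      rintro e ⟨x, rfl⟩
      exact hg e ⟨m * x, map_mul _ _ _⟩
    · have h1 : lead j (of m * g) = 1 :=
        lead_eq_one_of_ne (Ne.symm hj) (by rw [lead_of_mul, hlead, mul_one]; exact hm)
      rw [h1]
      by_cases hc : i = k ∧ g ∈ (of : M i →* CoprodI M).range
      · obtain ⟨rfl, x, rfl⟩ := hc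
        rw [← map_mul, ← map_mul]
        by_cases h0 : m * (x * h) = 1
        · rw [h0, map_one, lead_one]
        · exact lead_eq_one_of_ne (Ne.symm hj) (by rwa [lead_of])
      · refine lead_eq_one_of_ne (Ne.symm hj) ?_
        rw [lead_of_mul, ih i fun e hr => hc ⟨e, hr⟩, hlead, mul_one]
        exact hm

theorem finite_setOf_lead_mem (j : ι) (P : Set (M j)) (hP : ∀ h, {a | a ∈ P ∧ a * h ∉ P}.Finite)
    (x : CoprodI M) : {u : CoprodI M | lead j u ∈ P ∧ lead j (u * x) ∉ P}.Finite := by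
  induction x using lead_induction with
  | one =>
    convert Set.finite_empty
    ext u
    simp
  | cons k h x _ _ ih =>
    by_cases hjk : j = k
    · subst hjk
      refine ((ih.preimage (mul_left_injective (of h)).injOn).union
        ((hP h).image of)).subset ?_
      rintro u ⟨h1, h2⟩
      rw [← mul_assoc] at h2
      by_cases hu : lead j (u * of h) ∈ P
      · exact Or.inl ⟨hu, h2⟩
      · right
        by_cases hr : u ∈ (of : M j →* CoprodI M).range
        · obtain ⟨a, rfl⟩ := hr
          rw [lead_of] at h1
          rw [← map_mul, lead_of] at hu
          exact ⟨a, ⟨h1, hu⟩, rfl⟩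
        · rw [lead_mul_of j j u h fun _ => hr] at hu
          exact absurd h1 hu
    · refine (ih.preimage (mul_left_injective (of h)).injOn).subset ?_
      rintro u ⟨h1, h2⟩
      rw [← mul_assoc] at h2
      refine ⟨?_, h2⟩
      rwa [lead_mul_of j k u h fun e => absurd e hjk]

end Monoid.CoprodI

section FixFlow

open CoprodI

variable {J : Type*} {H : J → Type*} [∀ j, Group (H j)]

/-- Group elements together with cosets of the factors indexed by `E`. -/
abbrev CosetSpace (H : J → Type*) [∀ j, Group (H j)] (E : Set J) : Type _ :=
  CoprodI H ⊕ Σ j : E, CoprodI H ⧸ (of : H j →* CoprodI H).range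

/-- The positive powers of an element. -/
def posPowers {A : Type*} [Group A] (t : A) : Set A := {a | ∃ n : ℕ, a = t ^ (n + 1)}

variable (E : Set J) (φ : CoprodI H →* CoprodI H) (x : J → CoprodI H) (k : J → J) (t : ∀ j, H j)

open Classical in
/-- One step from `w` towards the factor `j`, in a direction determined by `a`. -/
noncomputable def flowStep (j : J) (a : H j) (w : CoprodI H) : CosetSpace H E :=
  if hj : j ∈ E then Sum.inr ⟨⟨j, hj⟩, w⟩
  else Sum.inl (w * of (if a ∈ posPowers (t j) then t j else (t j)⁻¹))

open Classical in
/-- The map moving every vertex one step towards its image under `φ`. -/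
noncomputable def fixFlow : CosetSpace H E → CosetSpace H E
  | Sum.inl w =>
    if h : ∃ j, lead j (w⁻¹ * φ w) ≠ 1 then
      flowStep E t h.choose (lead h.choose (w⁻¹ * φ w)) w
    else Sum.inl w
  | Sum.inr ⟨j, c⟩ =>
    if k j = j ∧ c.out⁻¹ * φ c.out * x j ∈ (of : H j →* CoprodI H).range then Sum.inr ⟨j, c⟩
    else Sum.inl (c.out * of (lead j.1 (c.out⁻¹ * φ c.out * x j)))

variable {E φ x k t}

theorem fixFlow_inl {j : J} {w : CoprodI H} (h : lead j (w⁻¹ * φ w) ≠ 1) :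
    fixFlow E φ x k t (Sum.inl w) = flowStep E t j (lead j (w⁻¹ * φ w)) w := by
  have h' : ∃ j, lead j (w⁻¹ * φ w) ≠ 1 := ⟨j, h⟩
  rw [fixFlow, dif_pos h']
  obtain rfl := eq_of_lead_ne_one h h'.choose_spec
  rfl

theorem fixFlow_inl_of_forall {w : CoprodI H} (h : ∀ j, lead j (w⁻¹ * φ w) = 1) :
    fixFlow E φ x k t (Sum.inl w) = Sum.inl w := by
  rw [fixFlow, dif_neg]
  simpa using h

theorem mul_of_inv_mul_map {j : J} (hx : ∀ h : H j, (x j)⁻¹ * φ (of h) * x j ∈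
    (of : H (k j) →* CoprodI H).range) (w : CoprodI H) (h : H j) :
    ∃ y ∈ (of : H (k j) →* CoprodI H).range,
      (w * of h)⁻¹ * φ (w * of h) * x j = (of h)⁻¹ * (w⁻¹ * φ w * x j * y) :=
  ⟨_, hx h, by simp only [map_mul, mul_inv_rev]; group⟩

theorem flow_terminal_iff {j : J} (hx : ∀ h : H j, (x j)⁻¹ * φ (of h) * x j ∈
    (of : H (k j) →* CoprodI H).range) (w : CoprodI H) (h : H j) :
    (k j = j ∧ (w * of h)⁻¹ * φ (w * of h) * x j ∈ (of : H j →* CoprodI H).range) ↔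
      (k j = j ∧ w⁻¹ * φ w * x j ∈ (of : H j →* CoprodI H).range) := by
  obtain ⟨y, hy, e⟩ := mul_of_inv_mul_map hx w h
  refine and_congr_right fun hk => ?_
  rw [hk] at hy
  have hh : of h ∈ (of : H j →* CoprodI H).range := ⟨h, rfl⟩
  rw [e, Subgroup.mul_mem_cancel_left _ (inv_mem hh), Subgroup.mul_mem_cancel_right _ hy]

theorem fixFlow_inr_of_terminal {j : E} (hx : ∀ h : H j, (x j)⁻¹ * φ (of h) * x j ∈
    (of : H (k j) →* CoprodI H).range) {w : CoprodI H}
    (hw : k j = j ∧ w⁻¹ * φ w * x j ∈ (of : H j →* CoprodI H).range) :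
    fixFlow E φ x k t (Sum.inr ⟨j, w⟩) = Sum.inr ⟨j, w⟩ := by
  obtain ⟨⟨_, h, rfl⟩, e⟩ := QuotientGroup.mk_out_eq_mul (of : H j →* CoprodI H).range w
  rw [fixFlow, if_pos]
  rw [e]
  exact (flow_terminal_iff hx w h).mpr hw

theorem fixFlow_inr {j : E} (hx : ∀ h : H j, (x j)⁻¹ * φ (of h) * x j ∈
    (of : H (k j) →* CoprodI H).range) {w : CoprodI H}
    (hw : ¬ (k j = j ∧ w⁻¹ * φ w * x j ∈ (of : H j →* CoprodI H).range)) :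
    fixFlow E φ x k t (Sum.inr ⟨j, w⟩) =
      Sum.inl (w * of (lead j.1 (w⁻¹ * φ w * x j))) := by
  obtain ⟨⟨_, h, rfl⟩, e⟩ := QuotientGroup.mk_out_eq_mul (of : H j →* CoprodI H).range w
  rw [fixFlow, if_neg]
  · rw [e]
    obtain ⟨_, ⟨y, rfl⟩, e'⟩ := mul_of_inv_mul_map hx w h
    rw [e', ← map_inv, lead_of_mul, lead_mul_of, mul_assoc w, ← map_mul, mul_inv_cancel_left]
    exact fun hk hr => hw ⟨hk.symm, hr⟩
  · rw [e]
    exact fun h' => hw ((flow_terminal_iff hx w h).mp h')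

theorem smul_inv_mul_map {γ : CoprodI H} (hγ : φ γ = γ) (w : CoprodI H) :
    (γ * w)⁻¹ * φ (γ * w) = w⁻¹ * φ w := by
  rw [map_mul, hγ]; group

theorem fixFlow_smul (hx : ∀ j ∈ E, ∀ h : H j, (x j)⁻¹ * φ (of h) * x j ∈
    (of : H (k j) →* CoprodI H).range) (γ : ↥(fixedSubgroup φ)) (z : CosetSpace H E) :
    fixFlow E φ x k t (γ • z) = γ • fixFlow E φ x k t z := by
  obtain ⟨γ, hγ⟩ := γ
  have hγ' : φ γ = γ := hγ
  change fixFlow E φ x k t (γ • z) = γ • fixFlow E φ x k t z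
  rcases z with w | ⟨j, c⟩
  · change fixFlow E φ x k t (Sum.inl (γ * w)) = _
    by_cases h : ∃ j, lead j (w⁻¹ * φ w) ≠ 1
    · obtain ⟨j, h⟩ := h
      rw [fixFlow_inl h, fixFlow_inl (j := j) (by rwa [smul_inv_mul_map hγ']),
        smul_inv_mul_map hγ', flowStep, flowStep]
      split_ifs
      · rfl
      · exact congrArg Sum.inl (mul_assoc _ _ _)
      · exact congrArg Sum.inl (mul_assoc _ _ _)
    · push Not at h
      rw [fixFlow_inl_of_forall h, fixFlow_inl_of_forall (by rwa [smul_inv_mul_map hγ'])]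
      rfl
  · obtain ⟨w, rfl⟩ := QuotientGroup.mk_surjective c
    change fixFlow E φ x k t (Sum.inr ⟨j, ((γ * w : CoprodI H) : CoprodI H ⧸ _)⟩) = _
    by_cases h : k j = j ∧ w⁻¹ * φ w * x j ∈ (of : H j →* CoprodI H).range
    · rw [fixFlow_inr_of_terminal (hx j j.2) h,
        fixFlow_inr_of_terminal (hx j j.2) (by rwa [smul_inv_mul_map hγ'])]
      rfl
    · rw [fixFlow_inr (hx j j.2) h,
        fixFlow_inr (hx j j.2) (by rwa [smul_inv_mul_map hγ']), smul_inv_mul_map hγ']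
      exact congrArg Sum.inl (mul_assoc _ _ _)

theorem stabilizer_inl (w : CoprodI H) :
    MulAction.stabilizer ↥(fixedSubgroup φ) (Sum.inl w : CosetSpace H E) = ⊥ := by
  refine (Subgroup.eq_bot_iff_forall _).mpr fun γ hγ => ?_
  have h : (Sum.inl (γ.1 * w) : CosetSpace H E) = Sum.inl w := hγ
  exact Subtype.ext (mul_eq_right.mp (Sum.inl_injective h))

theorem stabilizer_eq_bot_of_fixFlow_eq (hx : ∀ j ∈ E, ∀ h : H j, (x j)⁻¹ * φ (of h) * x j ∈
    (of : H (k j) →* CoprodI H).range) {z : CosetSpace H E} {w : CoprodI H}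
    (h : fixFlow E φ x k t z = Sum.inl w) : MulAction.stabilizer ↥(fixedSubgroup φ) z = ⊥ := by
  refine eq_bot_iff.mpr fun γ hγ => ?_
  rw [← stabilizer_inl (E := E) w, MulAction.mem_stabilizer_iff, ← h]
  exact (fixFlow_smul hx γ z).symm.trans (congrArg _ hγ)

theorem stabilizer_inr_fg (hφ : Function.Injective φ) {j : E} (hfg : FGFPMono (H j))
    (hx : ∀ h : H j, (x j)⁻¹ * φ (of h) * x j ∈ (of : H (k j) →* CoprodI H).range)
    {w : CoprodI H} (hw : k j = j ∧ w⁻¹ * φ w * x j ∈ (of : H j →* CoprodI H).range) :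
    (MulAction.stabilizer ↥(fixedSubgroup φ) (Sum.inr ⟨j, w⟩ : CosetSpace H E)).FG := by
  have hmem : ∀ h : H j, w⁻¹ * φ (w * of h * w⁻¹) * w ∈ (of : H j →* CoprodI H).range := by
    intro h
    have := hx h
    rw [hw.1] at this
    convert mul_mem (mul_mem hw.2 this) (inv_mem hw.2) using 1
    simp only [map_mul, map_inv]
    group
  let e : H j ≃* (of : H j →* CoprodI H).range := MonoidHom.ofInjective (of_injective j.1)
  let f₀ : H j →* CoprodI H := (MulAut.conj w⁻¹).toMonoidHom.comp
    (φ.comp ((MulAut.conj w).toMonoidHom.comp of))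
  have hf₀ : ∀ h, f₀ h = w⁻¹ * φ (w * of h * w⁻¹) * w := fun h => by simp [f₀]
  let f : H j →* H j := e.symm.toMonoidHom.comp
    (f₀.codRestrict _ fun h => by rw [hf₀]; exact hmem h)
  have hf : ∀ h, of (f h) = w⁻¹ * φ (w * of h * w⁻¹) * w := by
    intro h
    rw [← hf₀]
    exact congrArg Subtype.val (e.apply_symm_apply ⟨f₀ h, _⟩)
  have hfinj : Function.Injective f := by
    intro a b hab
    have := congrArg (of : H j →* CoprodI H) hab
    rw [hf, hf, mul_left_inj, mul_right_inj] at this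
    have := hφ this
    rw [mul_left_inj, mul_right_inj] at this
    exact of_injective _ this
  have hfix : ∀ h, f h = h ↔ φ (w * of h * w⁻¹) = w * of h * w⁻¹ := by
    intro h
    rw [← (of_injective j.1).eq_iff, hf, ← mul_left_inj w⁻¹, ← mul_right_inj w]
    group
  have hFG := hfg f hfinj
  rw [← Group.fg_iff_subgroup_fg]
  let q : ↥(fixedSubgroup f) →*
      ↥(MulAction.stabilizer ↥(fixedSubgroup φ) (Sum.inr ⟨j, w⟩ : CosetSpace H E)) :=
    { toFun := fun h => ⟨⟨w * of h.1 * w⁻¹, (hfix h.1).mp h.2⟩, by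
        rw [MulAction.mem_stabilizer_iff]
        change (Sum.inr ⟨j, ((w * of h.1 * w⁻¹ * w : CoprodI H) : CoprodI H ⧸ _)⟩ :
          CosetSpace H E) = _
        congr 2
        rw [inv_mul_cancel_right]
        exact QuotientGroup.mk_mul_of_mem _ ⟨h.1, rfl⟩⟩
      map_one' := by ext; simp
      map_mul' := fun a b => by ext; simp }
  refine Group.fg_of_surjective (f := q) ?_
  rintro ⟨⟨γ, hγ⟩, hs⟩
  rw [MulAction.mem_stabilizer_iff] at hs
  have hs' : (⟨j, ((γ * w : CoprodI H) : CoprodI H ⧸ _)⟩ :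
      Σ j : E, CoprodI H ⧸ (of : H j →* CoprodI H).range) = ⟨j, w⟩ := Sum.inr_injective hs
  have hs'' := eq_of_heq (Sigma.mk.inj hs').2
  obtain ⟨h, hh⟩ := QuotientGroup.eq.mp hs''.symm
  have hγ' : w * of h * w⁻¹ = γ := by rw [hh]; group
  exact ⟨⟨h, (hfix h).mpr (by rw [hγ']; exact hγ)⟩, Subtype.ext (Subtype.ext hγ')⟩

end FixFlow

section FixFlow

open CoprodI

variable {J : Type*} {H : J → Type*} [∀ j, Group (H j)] {E : Set J} {φ : CoprodI H →* CoprodI H}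
  {x : J → CoprodI H} {k : J → J} {t : ∀ j, H j}

theorem finite_setOf_fixFlow_inr_ne (j : E)
    (hx : ∀ h : H j, (x j)⁻¹ * φ (of h) * x j ∈ (of : H (k j) →* CoprodI H).range) :
    ∃ F : Set (CoprodI H), F.Finite ∧ ∀ w, w⁻¹ * φ w ∉ F →
      fixFlow E φ x k t (Sum.inl w) = Sum.inr ⟨j, w⟩ ∨
        fixFlow E φ x k t (Sum.inr ⟨j, w⟩) = Sum.inl w := by
  have hP : ∀ h : H j, {a | a ∈ ({1} : Set (H j)) ∧ a * h ∉ ({1} : Set (H j))}.Finite := fun h =>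
    (Set.finite_singleton 1).subset fun a ha => ha.1
  refine ⟨_, (finite_setOf_lead_mem j.1 {1} hP (x j)).union (Set.finite_singleton
    (of (lead j.1 (x j)⁻¹)⁻¹ * (x j)⁻¹)), fun w hw => ?_⟩
  rw [Set.mem_union, not_or] at hw
  by_cases h1 : lead j.1 (w⁻¹ * φ w) = 1
  · right
    by_cases h2 : k j = j ∧ w⁻¹ * φ w * x j ∈ (of : H j →* CoprodI H).range
    · obtain ⟨-, c, hc⟩ := h2
      have hu : w⁻¹ * φ w = of c * (x j)⁻¹ := by rw [hc]; group
      refine absurd ?_ hw.2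
      rw [hu, lead_of_mul] at h1
      rw [hu, eq_inv_of_mul_eq_one_left h1]
      rfl
    · rw [fixFlow_inr hx h2]
      have h3 : lead j.1 (w⁻¹ * φ w * x j) = 1 := by
        by_contra h3
        exact hw.1 ⟨h1, h3⟩
      rw [h3, map_one, mul_one]
  · left
    rw [fixFlow_inl h1, flowStep, dif_pos j.2]

theorem finite_setOf_mem_compl_posPowers {A : Type*} [Group A] {t : A}
    (ht : Function.Bijective fun n : ℤ => t ^ n) (h : A) :
    {a | a ∈ (posPowers t)ᶜ ∧ a * h ∉ (posPowers t)ᶜ}.Finite := by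
  obtain ⟨m, rfl⟩ := ht.2 h
  refine ((Set.finite_Icc (1 - m) 0).image fun n : ℤ => t ^ n).subset ?_
  rintro a ⟨h1, h2⟩
  obtain ⟨n, rfl⟩ := ht.2 a
  rw [Set.notMem_compl_iff] at h2
  obtain ⟨l, hl⟩ := h2
  refine ⟨n, ⟨?_, ?_⟩, rfl⟩
  · have : t ^ (n + m) = t ^ ((l : ℤ) + 1) := by rw [zpow_add]; exact_mod_cast hl
    have := ht.1 this
    omega
  · by_contra hn
    refine h1 ⟨(n - 1).toNat, ?_⟩
    change t ^ n = _
    rw [← zpow_natCast]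
    congr 1
    push_cast
    omega

theorem finite_setOf_fixFlow_inl_ne {j : J} (hj : j ∉ E)
    (ht : Function.Bijective fun n : ℤ => t j ^ n) :
    ∃ F : Set (CoprodI H), F.Finite ∧ ∀ w, w⁻¹ * φ w ∉ F →
      fixFlow E φ x k t (Sum.inl w) = Sum.inl (w * of (t j)) ∨
        fixFlow E φ x k t (Sum.inl (w * of (t j))) = Sum.inl w := by
  refine ⟨_, finite_setOf_lead_mem j _ (finite_setOf_mem_compl_posPowers ht) (φ (of (t j))),
    fun w hw => ?_⟩
  by_cases h1 : lead j (w⁻¹ * φ w) ∈ posPowers (t j)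
  · left
    rw [fixFlow_inl (j := j), flowStep, dif_neg hj, if_pos h1]
    intro h2
    rw [h2] at h1
    obtain ⟨n, hn⟩ := h1
    have : t j ^ (0 : ℤ) = t j ^ ((n : ℤ) + 1) := by rw [zpow_zero]; exact_mod_cast hn
    have := ht.1 this
    omega
  · right
    have h2 : lead j (w⁻¹ * φ w * φ (of (t j))) ∉ posPowers (t j) := by
      by_contra h2
      exact hw ⟨h1, not_not.mpr h2⟩
    have h3 : (w * of (t j))⁻¹ * φ (w * of (t j)) =
        of (t j)⁻¹ * (w⁻¹ * φ w * φ (of (t j))) := by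
      rw [map_mul, map_inv]; group
    have h4 : lead j ((w * of (t j))⁻¹ * φ (w * of (t j))) ≠ 1 := by
      rw [h3, lead_of_mul, Ne, inv_mul_eq_one]
      exact fun h => h2 ⟨0, by rw [← h]; simp⟩
    rw [fixFlow_inl h4, flowStep, dif_neg hj, if_neg]
    · rw [map_inv, mul_inv_cancel_right]
    · rintro ⟨n, hn⟩
      rw [h3, lead_of_mul, inv_mul_eq_iff_eq_mul] at hn
      exact h2 ⟨n + 1, by rw [hn, ← pow_succ']⟩

theorem fg_fixedSubgroup_of_elliptic_or_cyclic [Finite J] (hφ : Function.Injective φ)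
    (hfg : ∀ j, FGFPMono (H j))
    (hφH : ∀ j, (∃ (x : CoprodI H) (k : J), ∀ h : H j,
      x⁻¹ * φ (of h) * x ∈ (of : H k →* CoprodI H).range) ∨
        ∃ t : H j, Function.Bijective fun n : ℤ => t ^ n) :
    Group.FG ↥(fixedSubgroup φ) := by
  classical
  let E : Set J := {j | ∃ (x : CoprodI H) (k : J), ∀ h : H j,
      x⁻¹ * φ (of h) * x ∈ (of : H k →* CoprodI H).range}
  have h1 : ∀ j, ∃ (x : CoprodI H) (k : J), j ∈ E → ∀ h : H j,
      x⁻¹ * φ (of h) * x ∈ (of : H k →* CoprodI H).range := by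
    intro j
    by_cases hj : j ∈ E
    · obtain ⟨x, k, h⟩ := hj
      exact ⟨x, k, fun _ => h⟩
    · exact ⟨1, j, fun h => absurd h hj⟩
  choose x k hx using h1
  have h2 : ∀ j, ∃ t : H j, j ∉ E → Function.Bijective fun n : ℤ => t ^ n := by
    intro j
    by_cases hj : j ∈ E
    · exact ⟨1, fun h => absurd hj h⟩
    · obtain ⟨t, ht⟩ := (hφH j).resolve_left hj
      exact ⟨t, fun _ => ht⟩
  choose t ht using h2
  let nb : J → CoprodI H → CosetSpace H E := fun j w =>
    if hj : j ∈ E then Sum.inr ⟨⟨j, hj⟩, w⟩ else Sum.inl (w * of (t j))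
  have h3 : ∀ j, ∃ F : Set (CoprodI H), F.Finite ∧ ∀ w, w⁻¹ * φ w ∉ F →
      fixFlow E φ x k t (Sum.inl w) = nb j w ∨ fixFlow E φ x k t (nb j w) = Sum.inl w := by
    intro j
    by_cases hj : j ∈ E
    · simp only [nb, dif_pos hj]
      exact finite_setOf_fixFlow_inr_ne ⟨j, hj⟩ (hx j hj)
    · simp only [nb, dif_neg hj]
      exact finite_setOf_fixFlow_inl_ne hj (ht j hj)
  choose F hF hFw using h3
  let W : CoprodI H → CoprodI H := fun u => if h : ∃ w, w⁻¹ * φ w = u then h.choose else 1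
  have hW : ∀ w, (W (w⁻¹ * φ w))⁻¹ * φ (W (w⁻¹ * φ w)) = w⁻¹ * φ w := by
    intro w
    have h : ∃ w', w'⁻¹ * φ w' = w⁻¹ * φ w := ⟨w, rfl⟩
    simp only [W, dif_pos h]
    exact h.choose_spec
  let B : Set (CosetSpace H E × CosetSpace H E) :=
    ⋃ j, (fun u => (Sum.inl (W u), nb j (W u))) '' F j
  let R : CosetSpace H E → CosetSpace H E → Prop := fun y z =>
    z = fixFlow E φ x k t y ∨ ∃ δ : ↥(fixedSubgroup φ), ∃ e ∈ B, y = δ • e.1 ∧ z = δ • e.2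
  have hnb : ∀ j w, Relation.EqvGen R (Sum.inl w) (nb j w) := by
    intro j w
    by_cases hw : w⁻¹ * φ w ∈ F j
    · refine .rel _ _ (Or.inr ⟨⟨w * (W (w⁻¹ * φ w))⁻¹, ?_⟩, _,
        Set.mem_iUnion.mpr ⟨j, _, hw, rfl⟩, ?_, ?_⟩)
      · rw [mem_fixedSubgroup, map_mul, map_inv]
        have := hW w
        rw [inv_mul_eq_iff_eq_mul] at this
        rw [this]
        group
      · exact congrArg Sum.inl (inv_mul_cancel_right w _).symm
      · simp only [nb]
        split_ifs
        · refine congrArg Sum.inr ?_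
          refine congrArg (Sigma.mk _) ?_
          exact congrArg QuotientGroup.mk (inv_mul_cancel_right w _).symm
        · refine congrArg Sum.inl ?_
          change _ = w * (W (w⁻¹ * φ w))⁻¹ * (W (w⁻¹ * φ w) * of (t j))
          group
    · rcases hFw j w hw with h | h
      · exact .rel _ _ (Or.inl h.symm)
      · exact .symm _ _ (.rel _ _ (Or.inl h.symm))
  have hmul : ∀ j (h : H j) w, Relation.EqvGen R (Sum.inl w) (Sum.inl (w * of h)) := by
    intro j h w
    by_cases hj : j ∈ E
    · refine (hnb j w).trans _ _ _ ?_
      convert (hnb j (w * of h)).symm using 1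
      simp only [nb, dif_pos hj]
      refine congrArg Sum.inr (congrArg (Sigma.mk _) ?_)
      exact (QuotientGroup.mk_mul_of_mem w (MonoidHom.mem_range.mpr ⟨h, rfl⟩)).symm
    · have hstep : ∀ w, Relation.EqvGen R (Sum.inl w) (Sum.inl (w * of (t j))) := fun w => by
        simpa only [nb, dif_neg hj] using hnb j w
      obtain ⟨n, rfl⟩ := (ht j hj).2 h
      change Relation.EqvGen R (Sum.inl w) (Sum.inl (w * of (t j ^ n)))
      induction n using Int.induction_on with
      | zero => rw [zpow_zero, map_one, mul_one]; exact .refl _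
      | succ i hi =>
        refine hi.trans _ _ _ ?_
        rw [zpow_add_one, map_mul, ← mul_assoc]
        exact hstep _
      | pred i hi =>
        refine hi.trans _ _ _ (Relation.EqvGen.symm _ _ ?_)
        convert hstep (w * of (t j ^ (-(i : ℤ) - 1))) using 2
        rw [mul_assoc, ← map_mul, zpow_sub_one, inv_mul_cancel_right]
  have hall : ∀ g w, Relation.EqvGen R (Sum.inl w) (Sum.inl (w * g)) := by
    intro g
    induction g using CoprodI.induction_on with
    | one => intro w; rw [mul_one]; exact .refl _
    | of j h => exact hmul j h
    | mul a b ha hb =>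
      intro w
      rw [← mul_assoc]
      exact (ha w).trans _ _ _ (hb _)
  refine group_fg_of_flow (p := fixFlow E φ x k t) (B := B) (fixFlow_smul hx) ?_ ?_
    (Set.finite_iUnion fun j => (hF j).image _) (Sum.inl 1) fun γ => ?_
  · rintro (w | ⟨j, c⟩)
    · rw [stabilizer_inl]
      exact Subgroup.FG.bot
    · obtain ⟨w, rfl⟩ := QuotientGroup.mk_surjective c
      by_cases h : k j = j ∧ w⁻¹ * φ w * x j ∈ (of : H j →* CoprodI H).range
      · exact stabilizer_inr_fg hφ (hfg j) (hx j j.2) h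
      · rw [stabilizer_eq_bot_of_fixFlow_eq (t := t) hx (fixFlow_inr (hx j j.2) h)]
        exact Subgroup.FG.bot
  · rintro (w | ⟨j, c⟩) hne
    · exact stabilizer_inl w
    · obtain ⟨w, rfl⟩ := QuotientGroup.mk_surjective c
      by_cases h : k j = j ∧ w⁻¹ * φ w * x j ∈ (of : H j →* CoprodI H).range
      · exact absurd (fixFlow_inr_of_terminal (hx j j.2) h) hne
      · exact stabilizer_eq_bot_of_fixFlow_eq (t := t) hx (fixFlow_inr (hx j j.2) h)
  · have := hall γ 1
    rw [one_mul] at this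
    change Relation.EqvGen _ (Sum.inl 1) (Sum.inl (γ.1 * 1))
    rw [mul_one]
    exact this

end FixFlow

namespace Monoid.CoprodI

variable {I : Type*} {M : I → Type*} [∀ i, Group (M i)] {X : Type*} [MulAction (CoprodI M) X]

theorem exists_depth [MulAction.IsPretransitive (CoprodI M) X] (x₀ : X) :
    ∃ d : X → ℕ, ∀ x, x ≠ x₀ → ∃ (i : I) (m : M i), d ((of m : CoprodI M) • x) < d x := by
  classical
  let P : X → ℕ → Prop := fun x n =>
    ∃ l : List (Σ i, M i), (l.map fun p => (of p.2 : CoprodI M)).prod • x₀ = x ∧ l.length = n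
  have hP : ∀ x, ∃ n, P x n := fun x => by
    obtain ⟨g, rfl⟩ := MulAction.exists_smul_eq (CoprodI M) x₀ x
    exact ⟨_, (Word.equiv g).toList, congrArg (· • x₀) (Word.equiv.symm_apply_apply g), rfl⟩
  refine ⟨fun x => Nat.find (hP x), fun x hx => ?_⟩
  obtain ⟨l, hl, hn⟩ := Nat.find_spec (hP x)
  rcases l with _ | ⟨⟨i, m⟩, l⟩
  · exact absurd (by simpa using hl.symm) hx
  · refine ⟨i, m⁻¹, lt_of_le_of_lt (Nat.find_min' _ ⟨l, ?_, rfl⟩) (b := l.length) ?_⟩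
    · rw [← hl]
      simp [mul_smul]
    · change l.length < Nat.find (hP x)
      rw [← hn]
      simp

/-- A maximal tree in the graph of `X` and the orbits of the factors on `X`, rooted at `x₀`:
`b i x` is the vertex of the `M i`-orbit of `x` nearest to `x₀`, the element `t i x` moves it to `x`,
and `r x` moves `x₀` to `x` along the tree, the last edge having label `p x`. -/
theorem exists_tree [Nonempty I] [MulAction.IsPretransitive (CoprodI M) X] (x₀ : X) :
    ∃ (b : I → X → X) (t : ∀ i, X → M i) (r : X → CoprodI M) (p : X → I) (d : X → ℕ),
      (∀ i (m : M i) x, b i ((of m : CoprodI M) • x) = b i x) ∧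
      (∀ i x, (of (t i x) : CoprodI M) • b i x = x) ∧
      (∀ i x, b i x = x → t i x = 1) ∧
      r x₀ = 1 ∧ (∀ x, x ≠ x₀ → r x = of (t (p x) x) * r (b (p x) x)) ∧
      ∀ x, x ≠ x₀ → d (b (p x) x) < d x := by
  classical
  obtain ⟨d, hd⟩ := exists_depth (M := M) x₀
  have hmin : ∀ s : Set X, ∃ y, s.Nonempty → y ∈ s ∧ ∀ z ∈ s, d y ≤ d z := fun s => by
    by_cases hs : s.Nonempty
    · obtain ⟨y, hy, h⟩ := exists_minimalFor_of_wellFoundedLT (· ∈ s) d hs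
      exact ⟨y, fun _ => ⟨hy, fun z hz => (le_total (d y) (d z)).elim id (h hz)⟩⟩
    · exact ⟨x₀, fun h => absurd h hs⟩
  choose f hf using hmin
  let orb : I → X → Set X := fun i x => Set.range fun m : M i => (of m : CoprodI M) • x
  have horb : ∀ i x, (orb i x).Nonempty := fun i x => Set.range_nonempty _
  have ht : ∀ i x, ∃ m : M i, (of m : CoprodI M) • f (orb i x) = x ∧ (f (orb i x) = x → m = 1) := by
    intro i x
    by_cases h : f (orb i x) = x
    · exact ⟨1, by simpa using h, fun _ => rfl⟩
    · obtain ⟨m, hm⟩ := (hf _ (horb i x)).1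
      exact ⟨m⁻¹, by rw [← hm, ← mul_smul, ← map_mul]; simp, fun h' => absurd h' h⟩
  choose t ht using ht
  have hp : ∀ x, ∃ i : I, x ≠ x₀ → d (f (orb i x)) < d x := fun x => by
    by_cases hx : x = x₀
    · exact ⟨Classical.arbitrary I, fun h => absurd hx h⟩
    · obtain ⟨i, m, hm⟩ := hd x hx
      exact ⟨i, fun _ => ((hf _ (horb i x)).2 _ ⟨m, rfl⟩).trans_lt hm⟩
  choose p hp using hp
  let r : X → CoprodI M := WellFounded.fix (measure d).wf fun x rec =>
    if h : x = x₀ then 1 else of (t (p x) x) * rec (f (orb (p x) x)) (hp x h)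
  refine ⟨fun i x => f (orb i x), t, r, p, d, fun i m x => congrArg f ?_, fun i x => (ht i x).1,
    fun i x => (ht i x).2, ?_, fun x hx => ?_, hp⟩
  · refine Set.Subset.antisymm ?_ ?_
    · rintro _ ⟨m', rfl⟩
      exact ⟨m' * m, by simp [mul_smul]⟩
    · rintro _ ⟨m', rfl⟩
      exact ⟨m' * m⁻¹, by simp [mul_smul]⟩
  · exact (WellFounded.fix_eq _ _ _).trans (dif_pos rfl)
  · exact (WellFounded.fix_eq _ _ _).trans (dif_neg hx)

theorem exists_cocycle {K : Type*} [Group K] {b : I → X → X} {t : ∀ i, X → M i}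
    (hb : ∀ i (m : M i) x, b i ((of m : CoprodI M) • x) = b i x)
    (ht : ∀ i x, (of (t i x) : CoprodI M) • b i x = x)
    (s : ∀ i, X → M i → K) (hs : ∀ i x (m m' : M i), (of m : CoprodI M) • b i x = b i x →
      (of m' : CoprodI M) • b i x = b i x → s i (b i x) (m * m') = s i (b i x) m * s i (b i x) m')
    (k : I → X → K) :
    ∃ c : CoprodI M → X → K, (∀ g g' x, c (g * g') x = c g (g' • x) * c g' x) ∧
      ∀ i (m : M i) x, c (of m) x = k i ((of m : CoprodI M) • x) *
        s i (b i x) ((t i ((of m : CoprodI M) • x))⁻¹ * m * t i x) * (k i x)⁻¹ := by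
  let a : ∀ i, M i → X → K := fun i m x => k i ((of m : CoprodI M) • x) *
        s i (b i x) ((t i ((of m : CoprodI M) • x))⁻¹ * m * t i x) * (k i x)⁻¹
  have hs1 : ∀ i x, s i (b i x) 1 = 1 := fun i x => by
    have := hs i x 1 1 (by simp) (by simp)
    rwa [mul_one, left_eq_mul] at this
  have ha1 : ∀ i x, a i 1 x = 1 := fun i x => by simp [a, hs1]
  have hfix : ∀ i (m : M i) x,
      (of ((t i ((of m : CoprodI M) • x))⁻¹ * m * t i x) : CoprodI M) • b i x = b i x := by
    intro i m x
    rw [map_mul, map_mul, mul_smul, mul_smul, ht, map_inv, inv_smul_eq_iff]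
    conv_lhs => rw [← ht i ((of m : CoprodI M) • x)]
    rw [hb]
  have ham : ∀ i (m m' : M i) x, a i (m * m') x = a i m ((of m' : CoprodI M) • x) * a i m' x := by
    intro i m m' x
    have := hs i x _ _ (by simpa only [hb] using hfix i m ((of m' : CoprodI M) • x)) (hfix i m' x)
    simp only [a, hb, map_mul, mul_smul]
    simp only [mul_assoc, inv_mul_cancel_left, mul_inv_cancel_left] at this ⊢
    rw [this]
    simp only [mul_assoc]
  let A : ∀ i, M i →* Function.End (X × K) := fun i =>
    { toFun := fun m q => ((of m : CoprodI M) • q.1, a i m q.1 * q.2)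
      map_one' := funext fun q => by
        change ((of (1 : M i) : CoprodI M) • q.1, a i 1 q.1 * q.2) = q
        rw [map_one, one_smul, ha1, one_mul]
      map_mul' := fun m m' => funext fun q => by
        change ((of (m * m') : CoprodI M) • q.1, a i (m * m') q.1 * q.2) =
          ((of m : CoprodI M) • (of m' : CoprodI M) • q.1,
            a i m ((of m' : CoprodI M) • q.1) * (a i m' q.1 * q.2))
        rw [map_mul, mul_smul, ham, mul_assoc] }
  let Θ : CoprodI M → X × K → X × K := lift A
  have hone : ∀ q, Θ 1 q = q := congrFun (map_one (lift A))
  have hmul : ∀ g g' q, Θ (g * g') q = Θ g (Θ g' q) := fun g g' =>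
    congrFun (map_mul (lift A) g g')
  have hof : ∀ i (m : M i) q, Θ (of m) q = ((of m : CoprodI M) • q.1, a i m q.1 * q.2) :=
    fun i m => congrFun (lift_of A m)
  have h1 : ∀ g q, Θ g q = (g • q.1, (Θ g (q.1, 1)).2 * q.2) := by
    intro g
    induction g using CoprodI.induction_left with
    | one => intro q; simp [hone]
    | mul m w ih =>
      intro q
      rw [hmul, hmul, hof, hof, ih q, ih (q.1, 1)]
      simp [mul_smul, mul_assoc]
  refine ⟨fun g x => (Θ g (x, 1)).2, fun g g' x => ?_, fun i m x => ?_⟩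
  · change (Θ (g * g') (x, 1)).2 = (Θ g (g' • x, 1)).2 * (Θ g' (x, 1)).2
    rw [hmul, h1 g, h1 g']
  · change (Θ (of m) (x, 1)).2 = _
    rw [hof]
    exact mul_one _

end Monoid.CoprodI

namespace Monoid.CoprodI

universe u

instance sumElimGroup {U V : Type*} {P : U → Type u} {R : V → Type u} [∀ a, Group (P a)]
    [∀ a, Group (R a)] : ∀ a, Group (Sum.elim P R a)
  | Sum.inl a => inferInstanceAs (Group (P a))
  | Sum.inr a => inferInstanceAs (Group (R a))

theorem exists_sum_family {U V : Type*} (P : U → Type u) [∀ a, Group (P a)] :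
    ∃ (Q : U ⊕ V → Type u) (_ : ∀ a, Group (Q a)),
      (∀ a, Nonempty (P a ≃* Q (Sum.inl a))) ∧ ∀ a, Nonempty (Multiplicative ℤ ≃* Q (Sum.inr a)) :=
  ⟨Sum.elim P fun _ => ULift (Multiplicative ℤ), inferInstance, fun a => ⟨MulEquiv.refl (P a)⟩,
    fun _ => ⟨MulEquiv.ulift.symm⟩⟩

/-- **Kurosh subgroup theorem**: a subgroup of a free product is a free product of conjugates of
subgroups of the factors and of infinite cyclic groups. -/
theorem exists_mulEquiv_coprodI_of_injective {I : Type u} [Nonempty I] {M : I → Type u}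
    [∀ i, Group (M i)] {H : Type*} [Group H] (φ : H →* CoprodI M) (hφ : Function.Injective φ) :
    ∃ (A : Type u) (Q : A → Type u) (_ : ∀ a, Group (Q a)) (e : H ≃* CoprodI Q),
      ∀ a, (∃ (x : CoprodI M) (i : I), ∀ h, e h ∈ (of : Q a →* CoprodI Q).range →
        x⁻¹ * φ h * x ∈ (of : M i →* CoprodI M).range) ∨
          Nonempty (Multiplicative ℤ ≃* Q a) := by
  classical
  let X := CoprodI M ⧸ φ.range
  let x₀ : X := ((1 : CoprodI M) : X)
  have hφ₀ : ∀ g : CoprodI M, g • x₀ = x₀ ↔ ∃ h, φ h = g := fun g => by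
    have : g • x₀ = ((g * 1 : CoprodI M) : X) := rfl
    rw [this, mul_one, eq_comm, QuotientGroup.eq, inv_one, one_mul]
    rfl
  obtain ⟨b, t, r, p, d, hb, ht, ht1, hr0, hr, hd⟩ := exists_tree (M := M) x₀
  have hbb : ∀ i x, b i (b i x) = b i x := fun i x => by
    conv_rhs => rw [← ht i x, hb]
  let T : X × I → Prop := fun q => b q.2 q.1 = q.1 ∨ q.1 ≠ x₀ ∧ p q.1 = q.2
  obtain ⟨Q, hQ, eP, eR⟩ := exists_sum_family (U := {q : X × I // b q.2 q.1 = q.1})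
    (V := {q : X × I // ¬ T q})
    fun q => ↥((MulAction.stabilizer (CoprodI M) q.1.1).comap (of : M q.1.2 →* CoprodI M))
  replace eP := fun a => (eP a).some
  replace eR := fun a => (eR a).some
  let s : ∀ i, X → M i → CoprodI Q := fun i x m =>
    if h : b i x = x ∧ (of m : CoprodI M) • x = x then
      of (eP ⟨(x, i), h.1⟩ ⟨m, h.2⟩) else 1
  let k : I → X → CoprodI Q := fun i x =>
    if h : T (x, i) then 1 else of (eR ⟨(x, i), h⟩ (Multiplicative.ofAdd 1))
  have hs : ∀ i x (m m' : M i), (of m : CoprodI M) • b i x = b i x →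
      (of m' : CoprodI M) • b i x = b i x →
        s i (b i x) (m * m') = s i (b i x) m * s i (b i x) m' := by
    intro i x m m' h h'
    simp only [s]
    rw [dif_pos (show _ ∧ (of m : CoprodI M) • b i x = b i x from ⟨hbb i x, h⟩),
      dif_pos (show _ ∧ (of m' : CoprodI M) • b i x = b i x from ⟨hbb i x, h'⟩),
      dif_pos (show _ ∧ (of (m * m') : CoprodI M) • b i x = b i x from ⟨hbb i x, by
      rw [map_mul, mul_smul, h', h]⟩)]
    exact (congrArg of (map_mul (eP ⟨(b i x, i), hbb i x⟩) ⟨m, h⟩ ⟨m', h'⟩)).trans (map_mul of _ _)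
  have hs1 : ∀ i x, s i (b i x) 1 = 1 := fun i x => by
    have := hs i x 1 1 (by simp) (by simp)
    rwa [mul_one, left_eq_mul] at this
  obtain ⟨c, hc, hc'⟩ := exists_cocycle hb ht s hs k
  have hc1 : ∀ x, c 1 x = 1 := fun x => by
    have := hc 1 1 x
    rwa [mul_one, one_smul, left_eq_mul] at this
  have hrx : ∀ x, r x • x₀ = x := by
    intro x
    induction hn : d x using Nat.strong_induction_on generalizing x with
    | _ n ih =>
      by_cases hx : x = x₀
      · rw [hx, hr0, one_smul]
      · rw [hr x hx, mul_smul, ih _ (hn ▸ hd x hx) _ rfl, ht]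
  have hkb : ∀ i x, k i (b i x) = 1 := fun i x => dif_pos (Or.inl (hbb i x))
  have hct : ∀ i x, c (of (t i x)) (b i x) = k i x := fun i x => by
    rw [hc', ht, hbb, ht1 i (b i x) (hbb i x), hkb]
    simp [hs1]
  have hcr : ∀ x, c (r x) x₀ = 1 := by
    intro x
    induction hn : d x using Nat.strong_induction_on generalizing x with
    | _ n ih =>
      by_cases hx : x = x₀
      · rw [hx, hr0, hc1]
      · rw [hr x hx, hc, ih _ (hn ▸ hd x hx) _ rfl, hrx, hct, mul_one]
        exact dif_pos (Or.inr ⟨hx, rfl⟩)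
  have hcr' : ∀ x, c (r x)⁻¹ x = 1 := fun x => by
    have := hc (r x)⁻¹ (r x) x₀
    rwa [inv_mul_cancel, hc1, hcr, hrx, mul_one, eq_comm] at this
  obtain ⟨α, hαP, hαR⟩ : ∃ α : CoprodI Q →* CoprodI M,
      (∀ q m, α (of (eP q m)) = (r q.1.1)⁻¹ * of m.1 * r q.1.1) ∧
      ∀ q n, α (of (eR q n)) =
        ((r q.1.1)⁻¹ * of (t q.1.2 q.1.1) * r (b q.1.2 q.1.1)) ^ n.toAdd := by
    refine ⟨lift fun a => match a with
      | Sum.inl q => ((MulAut.conj (r q.1.1)⁻¹).toMonoidHom.comp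
          ((of : M q.1.2 →* CoprodI M).comp (Subgroup.subtype _))).comp (eP q).symm.toMonoidHom
      | Sum.inr q => (zpowersHom _ ((r q.1.1)⁻¹ * of (t q.1.2 q.1.1) * r (b q.1.2 q.1.1))).comp
          (eR q).symm.toMonoidHom, fun q m => ?_, fun q n => ?_⟩
    · rw [lift_of]
      change MulAut.conj (r q.1.1)⁻¹ (of ((eP q).symm (eP q m)).1) = _
      rw [MulEquiv.symm_apply_apply, MulAut.conj_apply, inv_inv]
    · rw [lift_of]
      change zpowersHom _ _ ((eR q).symm (eR q n)) = _
      rw [MulEquiv.symm_apply_apply, zpowersHom_apply]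
  have hαs : ∀ i x (m : M i), (of m : CoprodI M) • b i x = b i x →
      α (s i (b i x) m) = (r (b i x))⁻¹ * of m * r (b i x) := by
    intro i x m h
    simp only [s]
    rw [dif_pos ⟨hbb i x, h⟩, hαP]
  have hαk : ∀ i x, α (k i x) = (r x)⁻¹ * of (t i x) * r (b i x) := by
    intro i x
    by_cases h : T (x, i)
    · have : k i x = 1 := dif_pos h
      rw [this, map_one]
      rcases h with h | ⟨h, h'⟩
      · rw [ht1 i x h, show b i x = x from h]
        simp
      · obtain rfl : p x = i := h'
        rw [mul_assoc, ← hr x h, inv_mul_cancel]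
    · have : k i x = _ := dif_neg h
      rw [this, hαR]
      exact zpow_one _
  have hαc : ∀ g x, α (c g x) = (r (g • x))⁻¹ * g * r x := by
    intro g
    induction g using CoprodI.induction_left with
    | one => intro x; simp [hc1]
    | @mul i m w ih =>
      intro x
      rw [hc, map_mul, ih, hc', map_mul, map_mul, map_inv, hαk, hαk, hαs, hb, mul_smul]
      · simp [mul_assoc]
      · rw [map_mul, map_mul, mul_smul, mul_smul, ht, map_inv, inv_smul_eq_iff]
        conv_lhs => rw [← ht i ((of m : CoprodI M) • w • x)]
        rw [hb]
  have hφ1 : ∀ h, φ h • x₀ = x₀ := fun h => (hφ₀ _).2 ⟨h, rfl⟩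
  let β : H →* CoprodI Q :=
    { toFun := fun h => c (φ h) x₀
      map_one' := by rw [map_one, hc1]
      map_mul' := fun h h' => by rw [map_mul, hc, hφ1] }
  have hαβ : ∀ h, α (β h) = φ h := fun h => by
    change α (c (φ h) x₀) = _
    rw [hαc, hφ1, hr0]
    simp
  have hβ : ∀ g x y, g • x = y → c g x ∈ β.range := by
    rintro g x y rfl
    obtain ⟨h, hh⟩ := (hφ₀ ((r (g • x))⁻¹ * g * r x)).1 (by
      rw [mul_smul, mul_smul, hrx, inv_smul_eq_iff, hrx])
    refine ⟨h, ?_⟩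
    change c (φ h) x₀ = _
    rw [hh, hc, hc, hcr, hrx, hcr', one_mul, mul_one]
  have hsurj : β.range = ⊤ := by
    refine top_le_iff.mp fun z _ => ?_
    induction z using CoprodI.induction_on with
    | one => exact one_mem _
    | mul z z' hz hz' => exact mul_mem (hz trivial) (hz' trivial)
    | of a q =>
      rcases a with ⟨⟨x, i⟩, h⟩ | ⟨⟨x, i⟩, h⟩
      · obtain ⟨⟨m, hm⟩, rfl⟩ := (eP _).surjective q
        replace h : b i x = x := h
        replace hm : (of m : CoprodI M) • x = x := hm
        have := hβ (of m) x _ rfl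
        rw [hc', hm, ht1 i x h, h] at this
        have hk : k i x = 1 := dif_pos (Or.inl h)
        have hs : s i x m = _ := dif_pos ⟨h, hm⟩
        simpa [hk, hs] using this
      · obtain ⟨n, rfl⟩ := (eR _).surjective q
        have := hβ _ _ _ (ht i x)
        rw [hct] at this
        have hk : k i x = _ := dif_neg h
        rw [hk] at this
        convert zpow_mem this n.toAdd
        rw [← map_zpow, ← map_zpow, ← ofAdd_zsmul]
        simp
  have hinj : Function.Injective β := fun h h' e => hφ (by rw [← hαβ, e, hαβ])
  refine ⟨_, Q, hQ, MulEquiv.ofBijective β ⟨hinj, MonoidHom.range_eq_top.mp hsurj⟩, ?_⟩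
  rintro (⟨⟨x, i⟩, h⟩ | q)
  · refine Or.inl ⟨(r x)⁻¹, i, ?_⟩
    rintro h ⟨q, hq⟩
    obtain ⟨m, rfl⟩ := (eP _).surjective q
    refine ⟨m.1, ?_⟩
    have hq : β h = of (eP _ m) := hq.symm
    rw [← hαβ, hq, hαP]
    simp [mul_assoc]
  · exact Or.inr ⟨eR q⟩

end Monoid.CoprodI

/-- A group is freely indecomposable if in each of its free product decompositions at most one
factor is nontrivial. -/
def FreelyIndecomposable (A : Type) [Group A] : Prop :=
  ∀ (κ : Type) (B : κ → Type) [∀ k, Group (B k)], Nonempty (A ≃* CoprodI B) →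
    ∀ a a', Nontrivial (B a) → Nontrivial (B a') → a = a'

namespace Monoid.CoprodI

theorem nonempty_mulEquiv_sigma {ι : Type*} {A : ι → Type*} [∀ i, Group (A i)] {κ : ι → Type*}
    {B : ∀ i, κ i → Type*} [∀ i k, Group (B i k)] (e : ∀ i, A i ≃* CoprodI (B i)) :
    Nonempty (CoprodI A ≃* CoprodI fun p : Σ i, κ i => B p.1 p.2) := by
  let j : ∀ i, CoprodI (B i) →* CoprodI fun p : Σ i, κ i => B p.1 p.2 := fun i =>
    lift fun k => of (M := fun p : Σ i, κ i => B p.1 p.2) (i := ⟨i, k⟩)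
  let f : CoprodI A →* CoprodI fun p : Σ i, κ i => B p.1 p.2 :=
    lift fun i => (j i).comp (e i).toMonoidHom
  let g : (CoprodI fun p : Σ i, κ i => B p.1 p.2) →* CoprodI A :=
    lift fun p => (of.comp (e p.1).symm.toMonoidHom).comp of
  have hgj : ∀ i, g.comp (j i) = of.comp (e i).symm.toMonoidHom := fun i =>
    ext_hom _ _ fun k => by ext b; simp [g, j]
  refine ⟨f.toMulEquiv g (ext_hom _ _ fun i => ?_) (ext_hom _ _ fun p => ?_)⟩
  · ext a
    have := DFunLike.congr_fun (hgj i) (e i a)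
    simpa [f] using this
  · ext b
    simp [f, g, j]

theorem nonempty_mulEquiv_of_unique {κ : Type*} [Unique κ] (A : κ → Type*) [∀ k, Group (A k)] :
    Nonempty (A default ≃* CoprodI A) := by
  classical
  refine ⟨MulEquiv.ofBijective of ⟨of_injective _, ?_⟩⟩
  intro z
  induction z using CoprodI.induction_on with
  | one => exact ⟨1, map_one _⟩
  | of k a =>
    obtain rfl := Unique.eq_default k
    exact ⟨a, rfl⟩
  | mul x y hx hy =>
    obtain ⟨x, rfl⟩ := hx
    obtain ⟨y, rfl⟩ := hy
    exact ⟨x * y, map_mul _ _ _⟩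

theorem exists_range_of_eq_top {κ : Type*} [Nonempty κ] {B : κ → Type*} [∀ k, Group (B k)]
    (h : ∀ a a', Nontrivial (B a) → Nontrivial (B a') → a = a') :
    ∃ a, (of : B a →* CoprodI B).range = ⊤ := by
  classical
  obtain ⟨a, ha⟩ : ∃ a, ∀ a', Nontrivial (B a') → a' = a := by
    by_cases h' : ∃ a, Nontrivial (B a)
    · obtain ⟨a, ha⟩ := h'
      exact ⟨a, fun a' ha' => h _ _ ha' ha⟩
    · push Not at h'
      exact ⟨Classical.arbitrary κ, fun a' ha' => 
        absurd (h' a') (not_subsingleton_iff_nontrivial.mpr ha')⟩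
  refine ⟨a, top_le_iff.mp fun z _ => ?_⟩
  induction z using CoprodI.induction_on with
  | one => exact one_mem _
  | mul x y hx hy => exact mul_mem (hx trivial) (hy trivial)
  | of k b =>
    by_cases hk : Nontrivial (B k)
    · obtain rfl := ha k hk
      exact ⟨b, rfl⟩
    · have := not_nontrivial_iff_subsingleton.mp hk
      rw [Subsingleton.elim b 1, map_one]
      exact one_mem _

theorem nonempty_mulEquiv_subtype {ι : Type*} (L : ι → Type*) [∀ i, Group (L i)] (P : ι → Prop)
    (hP : ∀ i, ¬ P i → Subsingleton (L i)) :
    Nonempty (CoprodI L ≃* CoprodI fun i : {i // P i} => L i) := by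
  classical
  let f : CoprodI L →* CoprodI fun i : {i // P i} => L i :=
    lift fun i => if h : P i then of (M := fun i : {i // P i} => L i) (i := ⟨i, h⟩) else 1
  let g : (CoprodI fun i : {i // P i} => L i) →* CoprodI L := lift fun i => of
  refine ⟨f.toMulEquiv g (ext_hom _ _ fun i => ?_) (ext_hom _ _ fun i => ?_)⟩
  · ext a
    by_cases h : P i
    · simp [f, g, h]
    · have := hP i h
      rw [Subsingleton.elim a 1, map_one, map_one]
  · ext a
    simp [f, g, i.2]

theorem card_nontrivial_le' {ι : Type*} {L : ι → Type*} [∀ i, Group (L i)]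
    (S : Finset (CoprodI L)) (hS : Subgroup.closure (S : Set (CoprodI L)) = ⊤) (T : Finset ι)
    (hT : ∀ i ∈ T, Nontrivial (L i)) : T.card ≤ 2 * S.card := by
  classical
  let f : CoprodI L →* CoprodI fun i : T => L i :=
    lift fun i => if h : i ∈ T then of (M := fun i : T => L i) (i := ⟨i, h⟩) else 1
  have hf : Function.Surjective f := fun z => by
    refine ⟨(lift fun i => of : (CoprodI fun i : T => L i) →* CoprodI L) z, ?_⟩
    induction z using CoprodI.induction_on with
    | one => simp
    | of i a => simp [f]
    | mul x y hx hy => rw [map_mul, map_mul, hx, hy]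
  have h := card_nontrivial_le (L := fun i : T => L i) (S.image f) (by
    rw [Finset.coe_image, ← MonoidHom.map_closure, hS, ← MonoidHom.range_eq_map]
    exact MonoidHom.range_eq_top.mpr hf) Finset.univ fun i _ => hT i i.2
  rw [Finset.card_univ, Fintype.card_coe] at h
  exact h.trans (Nat.mul_le_mul_left 2 Finset.card_image_le)

theorem subsingleton_of_forall {ι : Type*} {L : ι → Type*} [∀ i, Group (L i)]
    (h : ∀ i, Subsingleton (L i)) : Subsingleton (CoprodI L) := by
  refine ⟨fun a b => ?_⟩
  have : ∀ z : CoprodI L, z = 1 := fun z =>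
    DFunLike.congr_fun (ext_hom (MonoidHom.id (CoprodI L)) 1 fun i => by
      ext l
      rw [Subsingleton.elim l 1, map_one, map_one]) z
  rw [this a, this b]

end Monoid.CoprodI

open CoprodI

/-- **Grushko decomposition**: a finitely generated group is a free product of finitely many
freely indecomposable groups. -/
theorem exists_mulEquiv_coprodI_freelyIndecomposable (A : Type) [Group A] [Group.FG A] :
    ∃ (ι : Type) (_ : Finite ι) (L : ι → Type) (_ : ∀ i, Group (L i)),
      Nonempty (A ≃* CoprodI L) ∧ ∀ i, FreelyIndecomposable (L i) := by
  classical
  let P : ℕ → Prop := fun m => ∃ (ι : Type) (L : ι → Type) (_ : ∀ i, Group (L i)) (T : Finset ι),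
    Nonempty (A ≃* CoprodI L) ∧ (∀ i ∈ T, Nontrivial (L i)) ∧ T.card = m
  obtain ⟨S, hS⟩ := Group.fg_def.mp ‹Group.FG A›
  have hbound : ∀ m, P m → m ≤ 2 * S.card := by
    rintro m ⟨ι, L, _, T, ⟨e⟩, hT, rfl⟩
    refine (card_nontrivial_le' (S.image e) ?_ T hT).trans
      (Nat.mul_le_mul_left 2 Finset.card_image_le)
    have := MonoidHom.map_closure e.toMonoidHom (S : Set A)
    rw [hS] at this
    rw [Finset.coe_image]
    refine this.symm.trans ?_
    rw [← MonoidHom.range_eq_map]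
    exact MonoidHom.range_eq_top.mpr e.surjective
  have hP0 : P 0 := ⟨Unit, fun _ => A, inferInstance, ∅,
    nonempty_mulEquiv_of_unique fun _ : Unit => A, by simp, rfl⟩
  obtain ⟨ι, L, hL, T, ⟨e⟩, hT, hm⟩ : P (Nat.findGreatest P (2 * S.card)) :=
    Nat.findGreatest_spec (Nat.zero_le _) hP0
  have hmax : ∀ m, P m → m ≤ T.card := fun m h =>
    hm ▸ Nat.le_findGreatest (hbound m h) h
  have hT' : ∀ i, Nontrivial (L i) → i ∈ T := fun i hi => by
    by_contra hiT
    have := hmax (insert i T).card ⟨ι, L, hL, insert i T, ⟨e⟩, by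
      intro j hj
      rcases Finset.mem_insert.mp hj with rfl | hj
      exacts [hi, hT j hj], rfl⟩
    rw [Finset.card_insert_of_notMem hiT] at this
    omega
  obtain ⟨e'⟩ := nonempty_mulEquiv_subtype L (· ∈ T) fun i hi =>
    not_nontrivial_iff_subsingleton.mp fun h => hi (hT' i h)
  refine ⟨T, inferInstance, fun i => L i, inferInstance, ⟨e.trans e'⟩, ?_⟩
  rintro ⟨i₀, hi₀⟩ κ₀ B₀ hB₀ ⟨e₀⟩ a a' ha ha'
  by_contra hne
  have key : ∀ i, ∃ (κ : Type) (B : κ → Type) (_ : ∀ k, Group (B k)) (U : Finset κ),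
      Nonempty (L i ≃* CoprodI B) ∧ (∀ k ∈ U, Nontrivial (B k)) ∧
        ((i ∈ T → 1 ≤ U.card) ∧ (i = i₀ → 2 ≤ U.card)) := by
    intro i
    by_cases hi : i = i₀
    · subst hi
      have hc : ({a, a'} : Finset κ₀).card = 2 := Finset.card_pair hne
      refine ⟨κ₀, B₀, hB₀, {a, a'}, ⟨e₀⟩, ?_, fun _ => by omega, fun _ => hc.ge⟩
      intro k hk
      rcases Finset.mem_insert.mp hk with rfl | hk
      · exact ha
      · rw [Finset.mem_singleton.mp hk]
        exact ha'
    · by_cases hiT : i ∈ T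
      · exact ⟨Unit, fun _ => L i, inferInstance, {()}, nonempty_mulEquiv_of_unique fun _ : Unit => L i,
          fun _ _ => hT i hiT, fun _ => by simp, fun h => absurd h hi⟩
      · exact ⟨Unit, fun _ => L i, inferInstance, ∅, nonempty_mulEquiv_of_unique fun _ : Unit => L i,
          by simp, fun h => absurd h hiT, fun h => absurd h hi⟩
  choose κ B hB U eB hU hc using key
  obtain ⟨E⟩ := nonempty_mulEquiv_sigma fun i => (eB i).some
  have := hmax _ ⟨Σ i, κ i, fun p => B p.1 p.2, inferInstance, T.sigma U, ⟨e.trans E⟩,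
    fun p hp => hU _ _ (Finset.mem_sigma.mp hp).2, rfl⟩
  rw [Finset.card_sigma] at this
  have h2 : ∑ i ∈ T, 1 < ∑ i ∈ T, (U i).card :=
    Finset.sum_lt_sum (fun i hi => (hc i).1 hi) ⟨i₀, hi₀, (hc i₀).2 rfl⟩
  rw [← Finset.card_eq_sum_ones] at h2
  omega

theorem FreelyIndecomposable.elliptic_or_cyclic {I : Type} [Nonempty I] {M : I → Type}
    [∀ i, Group (M i)] {A : Type} [Group A] (hA : FreelyIndecomposable A) (φ : A →* CoprodI M)
    (hφ : Function.Injective φ) :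
    (∃ (x : CoprodI M) (i : I), ∀ h : A, x⁻¹ * φ h * x ∈ (of : M i →* CoprodI M).range) ∨
      ∃ t : A, Function.Bijective fun n : ℤ => t ^ n := by
  obtain ⟨κ, Q, hQ, e, h⟩ := exists_mulEquiv_coprodI_of_injective φ hφ
  rcases isEmpty_or_nonempty κ with hκ | hκ
  · have := subsingleton_of_forall (L := Q) fun i => isEmptyElim i
    refine Or.inl ⟨1, Classical.arbitrary I, fun a => ?_⟩
    rw [e.injective (Subsingleton.elim (e a) (e 1))]
    simp
  obtain ⟨k, hk⟩ := exists_range_of_eq_top (hA κ Q ⟨e⟩)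
  rcases h k with ⟨x, i, h⟩ | ⟨⟨eZ⟩⟩
  · exact Or.inl ⟨x, i, fun a => h a (hk ▸ Subgroup.mem_top _)⟩
  · right
    have eQ : Q k ≃* CoprodI Q :=
      MulEquiv.ofBijective of ⟨of_injective k, MonoidHom.range_eq_top.mp hk⟩
    have E : Multiplicative ℤ ≃* A := (eZ.trans eQ).trans e.symm
    refine ⟨E (Multiplicative.ofAdd 1), ?_⟩
    have : (fun n : ℤ => E (Multiplicative.ofAdd 1) ^ n) = E ∘ Multiplicative.ofAdd := by
      funext n
      rw [← map_zpow, ← ofAdd_zsmul]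
      simp
    rw [this]
    exact E.bijective.comp Multiplicative.ofAdd.bijective

theorem FGFPMono.coprodI_of_freelyIndecomposable {J : Type} [Finite J] {L : J → Type}
    [∀ j, Group (L j)] (h : ∀ j, FGFPMono (L j)) (hL : ∀ j, FreelyIndecomposable (L j)) :
    FGFPMono (CoprodI L) := fun φ hφ =>
  fg_fixedSubgroup_of_elliptic_or_cyclic hφ h fun j =>
    have : Nonempty J := ⟨j⟩
    (hL j).elliptic_or_cyclic (φ.comp of) (hφ.comp (of_injective j))

theorem FGFPMono.coprodI {ι : Type} [Finite ι] {G : ι → Type} [∀ i, Group (G i)]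
    [∀ i, Group.FG (G i)] (h : ∀ i, FGFPMono (G i)) : FGFPMono (CoprodI G) := by
  choose κ hκ L hL e hind using fun i => exists_mulEquiv_coprodI_freelyIndecomposable (G i)
  obtain ⟨E⟩ := nonempty_mulEquiv_sigma fun i => (e i).some
  exact FGFPMono.of_mulEquiv E.symm (FGFPMono.coprodI_of_freelyIndecomposable
    (fun j => FGFPMono.of_coprodI ((h j.1).of_mulEquiv (e j.1).some) j.2) fun j => hind j.1 j.2)

/-- A free product `G₁ ∗ ⋯ ∗ G_n` has the finitely generated fixed subgroup property for
monomorphisms (`FGFP_m`) if and only if every factor `Gᵢ` does. -/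
theorem freeProduct_fgfp_monomorphism_iff (n : ℕ)
    (G : Fin n → Type) [∀ i, Group (G i)] [∀ i, Group.FG (G i)] :
    (∀ φ : Monoid.CoprodI G →* Monoid.CoprodI G, Function.Injective φ →
        Group.FG ↥(fixedSubgroup φ)) ↔
      (∀ (i : Fin n) (f : G i →* G i), Function.Injective f →
        Group.FG ↥(fixedSubgroup f)) :=
  ⟨fun h => FGFPMono.of_coprodI h, FGFPMono.coprodI⟩
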